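/- arXiv:2208.11391 — 2 statements merged into one kernel-verified Lean document; each statement's English description precedes it below -/
import Mathlib

section
/- (Two-step computation of the group SLOPE proximal problem) Let λ₁ ≥ ⋯ ≥ λ_p ≥ 0 with λ₁ > 0, and let Y ∈ ℝ^{p×K} have all rows y_j nonzero. Let η̂ ∈ ℝ^p be a minimizer of η ↦ ½ Σ_{j=1}^p (‖y_j‖ − η_j)² + P_λ(η). Then the unique minimizer Ĝ of G ↦ ½‖Y − G‖_F² + P_λ([[G]]) over G ∈ ℝ^{p×K} has rows ĝ_j = η̂_j · y_j/‖y_j‖ for j = 1,…,p. -/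
open Matrix

/-- The squared Frobenius norm of a matrix. -/
noncomputable def frobSq {m n : ℕ} (A : Matrix (Fin m) (Fin n) ℝ) : ℝ :=
  ∑ i, ∑ j, A i j ^ 2

/-- The vector of Euclidean row norms `[[G]]` of a matrix `G ∈ ℝ^{p×K}`. -/
noncomputable def rowNorms {p K : ℕ} (G : Matrix (Fin p) (Fin K) ℝ) : Fin p → ℝ :=
  fun j => Real.sqrt (∑ k, G j k ^ 2)

/-- The SLOPE penalty `P_λ(x) = Σ_j λ_j |x|_(j)`, where `|x|_(j)` is the `j`-th largest
component of `x` in magnitude. -/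
noncomputable def slopePen {p : ℕ} (lam x : Fin p → ℝ) : ℝ :=
  ∑ j, lam j * |x (Tuple.sort (fun i => |x i|) j.rev)|

theorem rowNorms_eq {p K : ℕ} (G : Matrix (Fin p) (Fin K) ℝ) (j : Fin p) :
    rowNorms G j = ‖(WithLp.toLp 2 (G j) : EuclideanSpace ℝ (Fin K))‖ := by
  simp [rowNorms, EuclideanSpace.norm_eq]

theorem rowNorms_nonneg {p K : ℕ} (G : Matrix (Fin p) (Fin K) ℝ) (j : Fin p) :
    0 ≤ rowNorms G j := Real.sqrt_nonneg _

theorem rowNorms_sq {p K : ℕ} (G : Matrix (Fin p) (Fin K) ℝ) (j : Fin p) :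
    rowNorms G j ^ 2 = ∑ k, G j k ^ 2 :=
  Real.sq_sqrt (Finset.sum_nonneg fun _ _ => sq_nonneg _)

theorem frobSq_eq {p K : ℕ} (G : Matrix (Fin p) (Fin K) ℝ) :
    frobSq G = ∑ j, rowNorms G j ^ 2 := by
  simp only [frobSq, rowNorms_sq]

theorem slopePen_abs {p : ℕ} (lam x : Fin p → ℝ) :
    slopePen lam (fun j => |x j|) = slopePen lam x := by
  simp [slopePen]

theorem sum_perm_le_slopePen {p : ℕ} (lam : Fin p → ℝ) (hmono : Antitone lam) (x : Fin p → ℝ)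
    (σ : Equiv.Perm (Fin p)) : ∑ j, lam j * |x (σ j)| ≤ slopePen lam x := by
  set τ : Equiv.Perm (Fin p) := Fin.revPerm.trans (Tuple.sort (fun i => |x i|)) with hτ
  have hanti : Antitone (fun j => |x (τ j)|) := by
    intro a b hab
    have := Tuple.monotone_sort (fun i => |x i|) (Fin.rev_le_rev.2 hab)
    simpa [hτ] using this
  have h := (hmono.monovary hanti).sum_mul_comp_perm_le_sum_mul (σ := σ.trans τ.symm)
  simpa [slopePen, hτ] using h

theorem slopePen_mid {p : ℕ} (lam : Fin p → ℝ) (hmono : Antitone lam)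
    (hnonneg : ∀ j, 0 ≤ lam j) (x y m : Fin p → ℝ) (hm : ∀ j, |m j| ≤ (|x j| + |y j|) / 2) :
    slopePen lam m ≤ (slopePen lam x + slopePen lam y) / 2 := by
  set τ : Equiv.Perm (Fin p) := Fin.revPerm.trans (Tuple.sort (fun i => |m i|)) with hτ
  have hx := sum_perm_le_slopePen lam hmono x τ
  have hy := sum_perm_le_slopePen lam hmono y τ
  have h0 : slopePen lam m = ∑ j, lam j * |m (τ j)| := by simp [slopePen, hτ]
  have h1 : ∑ j, lam j * |m (τ j)| ≤ ∑ j, lam j * ((|x (τ j)| + |y (τ j)|) / 2) :=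
    Finset.sum_le_sum fun j _ => mul_le_mul_of_nonneg_left (hm _) (hnonneg j)
  have h2 : ∑ j, lam j * ((|x (τ j)| + |y (τ j)|) / 2)
      = (∑ j, lam j * |x (τ j)| + ∑ j, lam j * |y (τ j)|) / 2 := by
    rw [← Finset.sum_add_distrib, Finset.sum_div]
    exact Finset.sum_congr rfl fun j _ => by ring
  linarith

theorem frobSq_mid {p K : ℕ} (Y G H : Matrix (Fin p) (Fin K) ℝ) :
    frobSq (Y - (1 / 2 : ℝ) • (G + H)) =
      (frobSq (Y - G) + frobSq (Y - H)) / 2 - frobSq (G - H) / 4 := by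
  simp only [frobSq, ← Finset.sum_add_distrib, Finset.sum_div, ← Finset.sum_sub_distrib]
  refine Finset.sum_congr rfl fun i _ => Finset.sum_congr rfl fun j _ => ?_
  simp only [Matrix.sub_apply, Matrix.smul_apply, Matrix.add_apply, smul_eq_mul]
  ring

theorem frobSq_sub_ge {p K : ℕ} (Y G : Matrix (Fin p) (Fin K) ℝ) :
    ∑ j, (rowNorms Y j - rowNorms G j) ^ 2 ≤ frobSq (Y - G) := by
  rw [frobSq_eq]
  refine Finset.sum_le_sum fun j _ => ?_
  rw [← sq_abs]
  refine pow_le_pow_left₀ (abs_nonneg _) ?_ 2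
  simp only [rowNorms_eq]
  exact abs_norm_sub_norm_le _ _

theorem rowNorms_mid {p K : ℕ} (G H : Matrix (Fin p) (Fin K) ℝ) (j : Fin p) :
    rowNorms ((1 / 2 : ℝ) • (G + H)) j ≤ (rowNorms G j + rowNorms H j) / 2 := by
  simp only [rowNorms_eq]
  have : (WithLp.toLp 2 (((1 / 2 : ℝ) • (G + H)) j) : EuclideanSpace ℝ (Fin K)) =
    (1 / 2 : ℝ) • (WithLp.toLp 2 (G j) + WithLp.toLp 2 (H j)) := rfl
  rw [this, norm_smul]
  have := norm_add_le (WithLp.toLp 2 (G j) : EuclideanSpace ℝ (Fin K)) (WithLp.toLp 2 (H j))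
  norm_num
  linarith

/-- Two-step computation of the group SLOPE proximal problem: if all rows of `Y` are
nonzero and `η̂` minimizes `η ↦ ½ Σ_j (‖y_j‖ − η_j)² + P_λ(η)`, then the matrix with rows
`ĝ_j = η̂_j y_j / ‖y_j‖` is the unique minimizer of `G ↦ ½‖Y − G‖_F² + P_λ([[G]])`. -/
theorem groupSlope_prox_two_step {p K : ℕ} (hp : 0 < p)
    (lam : Fin p → ℝ) (hmono : Antitone lam) (hnonneg : ∀ j, 0 ≤ lam j)
    (hpos : 0 < lam ⟨0, hp⟩)
    (Y : Matrix (Fin p) (Fin K) ℝ) (hY : ∀ j, Y j ≠ 0)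
    (ηhat : Fin p → ℝ)
    (hηhat : ∀ η : Fin p → ℝ,
      (1 / 2) * (∑ j, (rowNorms Y j - ηhat j) ^ 2) + slopePen lam ηhat ≤
        (1 / 2) * (∑ j, (rowNorms Y j - η j) ^ 2) + slopePen lam η) :
    (∀ G : Matrix (Fin p) (Fin K) ℝ,
        (1 / 2) * frobSq (Y - Matrix.of fun j k => ηhat j * Y j k / rowNorms Y j) +
            slopePen lam (rowNorms (Matrix.of fun j k => ηhat j * Y j k / rowNorms Y j)) ≤
          (1 / 2) * frobSq (Y - G) + slopePen lam (rowNorms G)) ∧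
      (∀ G : Matrix (Fin p) (Fin K) ℝ,
        (∀ G' : Matrix (Fin p) (Fin K) ℝ,
            (1 / 2) * frobSq (Y - G) + slopePen lam (rowNorms G) ≤
              (1 / 2) * frobSq (Y - G') + slopePen lam (rowNorms G')) →
          G = Matrix.of fun j k => ηhat j * Y j k / rowNorms Y j) := by
  have ha : ∀ j, 0 < rowNorms Y j := by
    intro j
    rw [rowNorms_eq, norm_pos_iff]
    intro h
    exact hY j (congrArg WithLp.ofLp h)
  have hη : ∀ j, 0 ≤ ηhat j := by
    by_contra! hcon
    obtain ⟨i, hi⟩ := hcon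
    have h := hηhat (fun j => |ηhat j|)
    rw [slopePen_abs] at h
    have hlt : ∑ j, (rowNorms Y j - |ηhat j|) ^ 2 < ∑ j, (rowNorms Y j - ηhat j) ^ 2 := by
      refine Finset.sum_lt_sum (fun j _ => ?_) ⟨i, Finset.mem_univ _, ?_⟩
      · nlinarith [ha j, le_abs_self (ηhat j), sq_abs (ηhat j)]
      · rw [abs_of_neg hi]
        nlinarith [ha i]
    linarith
  set H : Matrix (Fin p) (Fin K) ℝ := Matrix.of fun j k => ηhat j * Y j k / rowNorms Y j with hH
  have hHrow : rowNorms H = ηhat := by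
    funext j
    have h : rowNorms H j ^ 2 = ηhat j ^ 2 := by
      have h1 : ∀ k, H j k ^ 2 = ηhat j ^ 2 / rowNorms Y j ^ 2 * Y j k ^ 2 := by
        intro k
        simp only [hH, Matrix.of_apply]
        ring
      rw [rowNorms_sq, Finset.sum_congr rfl fun k _ => h1 k, ← Finset.mul_sum, ← rowNorms_sq]
      have := (ha j).ne'
      field_simp
    exact (pow_left_inj₀ (rowNorms_nonneg _ _) (hη j) two_ne_zero).1 h
  have hHfrob : frobSq (Y - H) = ∑ j, (rowNorms Y j - ηhat j) ^ 2 := by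
    unfold frobSq
    refine Finset.sum_congr rfl fun j _ => ?_
    have hne := (ha j).ne'
    have h1 : ∀ k, (Y - H) j k ^ 2 =
        (rowNorms Y j - ηhat j) ^ 2 / rowNorms Y j ^ 2 * Y j k ^ 2 := by
      intro k
      simp only [hH, Matrix.of_apply, Matrix.sub_apply]
      field_simp
    rw [Finset.sum_congr rfl fun k _ => h1 k, ← Finset.mul_sum, ← rowNorms_sq]
    field_simp
  have hmin : ∀ G : Matrix (Fin p) (Fin K) ℝ,
      (1 / 2) * frobSq (Y - H) + slopePen lam (rowNorms H) ≤
        (1 / 2) * frobSq (Y - G) + slopePen lam (rowNorms G) := by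
    intro G
    have h1 := hηhat (rowNorms G)
    have h2 := frobSq_sub_ge Y G
    rw [hHrow, hHfrob]
    linarith
  refine ⟨hmin, fun G hG => ?_⟩
  have h1 := hG H
  have h2 := hmin ((1 / 2 : ℝ) • (G + H))
  rw [frobSq_mid] at h2
  have h3 := slopePen_mid lam hmono hnonneg (rowNorms G) (rowNorms H)
    (rowNorms ((1 / 2 : ℝ) • (G + H))) (fun j => by
      simp only [abs_of_nonneg (rowNorms_nonneg _ _)]
      exact rowNorms_mid G H j)
  have h4 : frobSq (G - H) ≤ 0 := by linarith
  ext j k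
  have hj : ∑ k, (G - H) j k ^ 2 ≤ frobSq (G - H) :=
    Finset.single_le_sum (f := fun i => ∑ k, (G - H) i k ^ 2)
      (fun i _ => Finset.sum_nonneg fun _ _ => sq_nonneg _) (Finset.mem_univ j)
  have hk : (G - H) j k ^ 2 ≤ ∑ k, (G - H) j k ^ 2 :=
    Finset.single_le_sum (f := fun k => (G - H) j k ^ 2)
      (fun _ _ => sq_nonneg _) (Finset.mem_univ k)
  have h0 : (G - H) j k = 0 := by
    have : (G - H) j k ^ 2 = 0 := le_antisymm (by linarith) (sq_nonneg _)
    exact pow_eq_zero_iff two_ne_zero |>.1 this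
  rw [Matrix.sub_apply] at h0
  linarith
end

section
/- (Theorem 2, asymptotic risk upper bound) Fix σ > 0, K ≥ 1, d ≥ K and ᾱ > 0. Let (p_t)_t and (s_t)_t be sequences of positive integers with p_t → ∞ and s_t/p_t → 0. For each t, let n_t ≥ p_t, let X_t ∈ ℝ^{n_t×p_t} satisfy X_tᵀX_t = I_{p_t}, set λ_j^{(t)} = σ·F_{χ_K}^{-1}(1 − q·j/p_t) for some fixed 0 < q < 1, and for G* ∈ ℝ^{p_t×K} and column-orthonormal H* ∈ ℝ^{d×K} let Y = X_t G* H*ᵀ + E with i.i.d. N(0,σ²) entries of E. Let (Ĝ, Ĥ) be any measurable selection of optimal solutions of the TgSLOPE problem: minimize ½‖Y − X G Hᵀ‖_F² + P_{λ^{(t)}}([[G]]) over G ∈ ℝ^{p_t×K} and column-orthonormal H ∈ ℝ^{d×K}, and set B̂ = Ĝ Ĥᵀ, B* = G* H*ᵀ ∈ ℝ^{p_t×d}. Then limsup_{t→∞} [ sup E‖[[B̂]] − [[B*]]‖² ] / (2σ² s_t log(p_t/s_t)) ≤ 1, where the supremum is over all pairs (G*, H*) as above such that G* has at most s_t nonzero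 rows and every row of B* has Euclidean norm at most ᾱ. -/
open Matrix MeasureTheory ProbabilityTheory Filter

/-- The CDF `F_{χ_K}` of the chi distribution with `K` degrees of freedom: the CDF of the
Euclidean norm of a standard Gaussian vector in `ℝ^K`. -/
noncomputable def chiCDF (K : ℕ) (t : ℝ) : ℝ :=
  ((Measure.pi fun _ : Fin K => gaussianReal 0 1)
    {x | Real.sqrt (∑ k, x k ^ 2) ≤ t}).toReal

/-- The `a`-quantile `F_{χ_K}^{-1}(a)` of the chi distribution with `K` degrees of
freedom. -/
noncomputable def chiQuantile (K : ℕ) (a : ℝ) : ℝ :=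
  sInf {t : ℝ | a ≤ chiCDF K t}


/-- The iid Gaussian measure on matrices. -/
noncomputable abbrev gm (n d : ℕ) (v : NNReal) : Measure (Fin n → Fin d → ℝ) :=
  Measure.pi fun _ : Fin n => Measure.pi fun _ : Fin d => gaussianReal 0 v

lemma gm_char (n d : ℕ) (v : NNReal) (A : Fin n → Fin d → ℝ) :
    ∫ E, Complex.exp (((∑ i, ∑ l, A i l * E i l : ℝ) : ℂ) * Complex.I) ∂(gm n d v) =
      Complex.exp (-(v * (∑ i, ∑ l, A i l ^ 2 : ℝ)) / 2) := by
  have h1 : ∀ E : Fin n → Fin d → ℝ,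
      Complex.exp (((∑ i, ∑ l, A i l * E i l : ℝ) : ℂ) * Complex.I) =
      ∏ i, (fun i (e : Fin d → ℝ) => ∏ l, (fun l (x : ℝ) =>
        Complex.exp ((A i l : ℂ) * x * Complex.I)) l (e l)) i (E i) := by
    intro E
    simp only
    simp_rw [← Complex.exp_sum]
    push_cast
    simp_rw [Finset.sum_mul]
  refine (integral_congr_ae (ae_of_all _ h1)).trans ?_
  refine (integral_fintype_prod_eq_prod (𝕜 := ℂ) (fun i (e : Fin d → ℝ) => ∏ l,
    (fun l (x : ℝ) => Complex.exp ((A i l : ℂ) * x * Complex.I)) l (e l))).trans ?_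
  have h2 : ∀ i l, ∫ x, Complex.exp ((A i l : ℂ) * x * Complex.I) ∂(gaussianReal 0 v) =
      Complex.exp (-(v * (A i l : ℂ) ^ 2) / 2) := by
    intro i l
    have := charFun_gaussianReal (μ := 0) (v := v) (A i l)
    rw [charFun_apply_real] at this
    rw [this]
    congr 1
    push_cast
    ring
  have h3 : ∀ i, ∫ e : Fin d → ℝ, ∏ l, (fun l (x : ℝ) => Complex.exp ((A i l : ℂ) * x * Complex.I)) l (e l)
      ∂(Measure.pi fun _ : Fin d => gaussianReal 0 v) =
      ∏ l, Complex.exp (-(v * (A i l : ℂ) ^ 2) / 2) := by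
    intro i
    rw [integral_fintype_prod_eq_prod (𝕜 := ℂ) (fun l (x : ℝ) =>
        Complex.exp ((A i l : ℂ) * x * Complex.I))]
    simp_rw [h2]
  refine (Finset.prod_congr rfl fun i _ => h3 i).trans ?_
  simp_rw [← Complex.exp_sum]
  congr 1
  push_cast
  simp_rw [Finset.mul_sum, ← Finset.sum_neg_distrib, Finset.sum_div]

lemma frobSq_eq_trace {m n : ℕ} (A : Matrix (Fin m) (Fin n) ℝ) :
    frobSq A = (Aᵀ * A).trace := by
  simp only [frobSq, Matrix.trace, Matrix.diag, Matrix.mul_apply, Matrix.transpose_apply]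
  rw [Finset.sum_comm]
  simp [sq]

lemma frobSq_mul_left {n p d : ℕ} (X : Matrix (Fin n) (Fin p) ℝ) (hX : Xᵀ * X = 1)
    (A : Matrix (Fin p) (Fin d) ℝ) : frobSq (X * A) = frobSq A := by
  rw [frobSq_eq_trace, frobSq_eq_trace, Matrix.transpose_mul, Matrix.mul_assoc,
    ← Matrix.mul_assoc Xᵀ, hX, Matrix.one_mul]

lemma frobSq_transpose {m n : ℕ} (A : Matrix (Fin m) (Fin n) ℝ) : frobSq Aᵀ = frobSq A := by
  simp only [frobSq, Matrix.transpose_apply]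
  exact Finset.sum_comm

lemma frobSq_mul_right {p d K : ℕ} (H : Matrix (Fin d) (Fin K) ℝ) (hH : Hᵀ * H = 1)
    (A : Matrix (Fin p) (Fin K) ℝ) : frobSq (A * Hᵀ) = frobSq A := by
  rw [← frobSq_transpose, Matrix.transpose_mul, Matrix.transpose_transpose,
    frobSq_mul_left H hH, frobSq_transpose]

/-- the Frobenius inner product -/
noncomputable def fip {m n : ℕ} (A B : Matrix (Fin m) (Fin n) ℝ) : ℝ := ∑ i, ∑ l, A i l * B i l

lemma fip_trace {m n : ℕ} (A B : Matrix (Fin m) (Fin n) ℝ) : fip A B = (Aᵀ * B).trace := by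
  simp only [fip, Matrix.trace, Matrix.diag, Matrix.mul_apply, Matrix.transpose_apply]
  rw [Finset.sum_comm]

lemma fip_mul_left {n p d : ℕ} (X : Matrix (Fin n) (Fin p) ℝ)
    (A : Matrix (Fin p) (Fin d) ℝ) (B : Matrix (Fin n) (Fin d) ℝ) :
    fip A (Xᵀ * B) = fip (X * A) B := by
  rw [fip_trace, fip_trace, Matrix.transpose_mul, Matrix.mul_assoc]

lemma fip_mul_right {p d K : ℕ} (H : Matrix (Fin d) (Fin K) ℝ)
    (A : Matrix (Fin p) (Fin K) ℝ) (B : Matrix (Fin p) (Fin d) ℝ) :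
    fip A (B * H) = fip (A * Hᵀ) B := by
  rw [fip_trace, fip_trace, Matrix.transpose_mul, Matrix.transpose_transpose, ← Matrix.mul_assoc,
    Matrix.trace_mul_comm, Matrix.mul_assoc]

lemma gm_law (n d p K : ℕ) (v w : NNReal) (a : ℝ) (hw : (w : ℝ) = a ^ 2 * v)
    (X : Matrix (Fin n) (Fin p) ℝ) (hX : Xᵀ * X = 1)
    (H : Matrix (Fin d) (Fin K) ℝ) (hH : Hᵀ * H = 1) :
    Measure.map (fun E : Fin n → Fin d → ℝ => fun i k => a * (Xᵀ * Matrix.of E * H) i k)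
      (gm n d v) = gm p K w := by
  have hmeas : Measurable (fun E : Fin n → Fin d → ℝ =>
      fun i k => a * (Xᵀ * Matrix.of E * H) i k) := by
    refine measurable_pi_lambda _ fun i => measurable_pi_lambda _ fun k => ?_
    simp only [Matrix.mul_apply, Matrix.of_apply]
    fun_prop
  have : IsProbabilityMeasure (Measure.map (fun E : Fin n → Fin d → ℝ =>
      fun i k => a * (Xᵀ * Matrix.of E * H) i k) (gm n d v)) :=
    Measure.isProbabilityMeasure_map hmeas.aemeasurable
  refine Measure.ext_of_charFunDual ?_
  ext L
  obtain ⟨A, hA⟩ : ∃ A : Fin p → Fin K → ℝ, ∀ x, L x = ∑ i, ∑ l, A i l * x i l := by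
    refine ⟨fun i l => L (Pi.single i (Pi.single l 1)), fun x => ?_⟩
    conv_lhs => rw [← Finset.univ_sum_single x]
    rw [map_sum]
    refine Finset.sum_congr rfl fun i _ => ?_
    have : (Pi.single i (x i) : Fin p → Fin K → ℝ) =
        ∑ l, x i l • Pi.single i (Pi.single l (1:ℝ)) := by
      conv_lhs => rw [← Finset.univ_sum_single (x i)]
      ext i' l'
      by_cases h : i' = i
      · subst h
        simp [Finset.sum_apply, Pi.single_apply]
      · simp [Finset.sum_apply, h]
    rw [this, map_sum]
    simp [mul_comm]
  rw [charFunDual_apply, charFunDual_apply, integral_map hmeas.aemeasurable (by fun_prop)]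
  simp_rw [hA]
  rw [gm_char]
  have h3 : ∀ E : Fin n → Fin d → ℝ, ∑ i, ∑ l, A i l * (a * (Xᵀ * Matrix.of E * H) i l) =
      ∑ i, ∑ l, (a * (X * Matrix.of A * Hᵀ) i l) * E i l := by
    intro E
    have h4 := fip_mul_right H (Matrix.of A) (Xᵀ * Matrix.of E)
    rw [fip_mul_left, ← Matrix.mul_assoc] at h4
    simp only [fip, Matrix.of_apply] at h4
    simp_rw [mul_assoc a, ← Finset.mul_sum, ← h4, Finset.mul_sum]
    refine Finset.sum_congr rfl fun i _ => Finset.sum_congr rfl fun l _ => by ring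
  simp_rw [h3]
  rw [gm_char]
  have h5 : frobSq (X * Matrix.of A * Hᵀ) = frobSq (Matrix.of A) := by
    rw [frobSq_mul_right H hH, frobSq_mul_left X hX]
  simp only [frobSq, Matrix.of_apply] at h5
  congr 3
  simp_rw [mul_pow, ← Finset.mul_sum, h5]
  have : (w : ℂ) = (a:ℂ)^2 * v := by exact_mod_cast hw
  rw [this]
  push_cast
  ring

lemma det_slope {p : ℕ} (v g lam : Fin p → ℝ) (hg : ∀ i, 0 ≤ g i) (D : ℝ) (hD : 0 ≤ D) (m : ℕ)
    (h1 : ∀ j : Fin p, j.val < m → ∀ i, v i ≤ lam j + D)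
    (h2 : ∀ j : Fin p, m ≤ j.val → (Finset.univ.filter fun i => lam j < v i).card ≤ j.val) :
    ∑ i, v i * g i ≤ slopePen lam g + √m * D * √(∑ i, g i ^ 2) := by
  set π : Equiv.Perm (Fin p) := Fin.revPerm.trans (Tuple.sort (fun i => |g i|)) with hπ
  set τ : Equiv.Perm (Fin p) := Fin.revPerm.trans (Tuple.sort v) with hτ
  have hπa : Antitone fun j => |g (π j)| := by
    intro i j hij
    exact Tuple.monotone_sort (fun i => |g i|) (Fin.rev_le_rev.2 hij)
  have hτa : Antitone fun j => v (τ j) := by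
    intro i j hij
    exact Tuple.monotone_sort v (Fin.rev_le_rev.2 hij)
  have hpen : slopePen lam g = ∑ j, lam j * |g (π j)| := rfl
  have hr : ∑ i, v i * g i ≤ ∑ j, v (τ j) * |g (π j)| := by
    have hmv : Monovary (fun j => v (τ j)) (fun j => |g (π j)|) := hτa.monovary hπa
    have := hmv.sum_comp_perm_mul_le_sum_mul (σ := π.trans τ.symm)
    refine le_trans (le_of_eq ?_) this
    rw [← Equiv.sum_comp π]
    refine Finset.sum_congr rfl fun i _ => ?_
    simp [abs_of_nonneg (hg _)]
  have hb : ∀ j : Fin p, m ≤ j.val → v (τ j) ≤ lam j := by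
    intro j hj
    by_contra! hlt
    have hsub : (Finset.Iic j).image τ ⊆ Finset.univ.filter fun i => lam j < v i := by
      intro i hi
      obtain ⟨k, hk, rfl⟩ := Finset.mem_image.1 hi
      simp only [Finset.mem_filter, Finset.mem_univ, true_and]
      exact hlt.trans_le (hτa (Finset.mem_Iic.1 hk))
    have := (Finset.card_le_card hsub).trans (h2 j hj)
    rw [Finset.card_image_of_injective _ τ.injective, Fin.card_Iic] at this
    omega
  have hterm : ∀ j, v (τ j) * |g (π j)| ≤
      lam j * |g (π j)| + D * (if j.val < m then 1 else 0) * |g (π j)| := by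
    intro j
    rw [← add_mul]
    refine mul_le_mul_of_nonneg_right ?_ (abs_nonneg _)
    split_ifs with h
    · simpa using h1 j h _
    · simpa using hb j (not_lt.1 h)
  have hcs : ∑ j : Fin p, (if j.val < m then (1:ℝ) else 0) * |g (π j)| ≤
      √m * √(∑ i, g i ^ 2) := by
    refine (Real.sum_mul_le_sqrt_mul_sqrt _ _ _).trans ?_
    simp only [sq_abs]
    rw [Equiv.sum_comp π (fun i => g i ^ 2)]
    gcongr
    · have : ∀ j : Fin p, (if j.val < m then (1:ℝ) else 0) ^ 2 = if j.val < m then (1:ℝ) else 0 := by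
        intro j; split_ifs <;> simp
      simp_rw [this]
      rw [Finset.sum_boole]
      norm_cast
      have := Finset.card_le_card_of_injOn (s := Finset.univ.filter fun j : Fin p => j.val < m)
        (t := Finset.range m) (fun j => j.val) (by intro j; simp) (Fin.val_injective.injOn)
      simpa using this
  calc _ ≤ _ := hr
    _ ≤ ∑ j, (lam j * |g (π j)| + D * (if j.val < m then 1 else 0) * |g (π j)|) :=
      Finset.sum_le_sum fun j _ => hterm j
    _ = slopePen lam g + D * ∑ j : Fin p, (if j.val < m then (1:ℝ) else 0) * |g (π j)| := by
      rw [Finset.sum_add_distrib, hpen, Finset.mul_sum]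
      congr 1
      exact Finset.sum_congr rfl fun j _ => by ring
    _ ≤ _ := by
      have := mul_le_mul_of_nonneg_left hcs hD
      linarith

/-- standard Gaussian on `ℝ^K` -/
noncomputable abbrev g1 (K : ℕ) : Measure (Fin K → ℝ) := Measure.pi fun _ : Fin K => gaussianReal 0 1

lemma meas_nrm (K : ℕ) : Measurable fun x : Fin K → ℝ => Real.sqrt (∑ k, x k ^ 2) := by fun_prop

lemma chiCDF_eq_cdf (K : ℕ) (t : ℝ) :
    chiCDF K t = cdf (Measure.map (fun x : Fin K → ℝ => Real.sqrt (∑ k, x k ^ 2)) (g1 K)) t := by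
  have : IsProbabilityMeasure (Measure.map (fun x : Fin K → ℝ => Real.sqrt (∑ k, x k ^ 2)) (g1 K)) :=
    Measure.isProbabilityMeasure_map (meas_nrm K).aemeasurable
  rw [cdf_eq_real, Measure.real, Measure.map_apply (meas_nrm K) measurableSet_Iic]
  rfl

lemma chiCDF_mono (K : ℕ) : Monotone (chiCDF K) := by
  intro a b h
  rw [chiCDF_eq_cdf, chiCDF_eq_cdf]
  exact (cdf _).mono h

lemma chi_quantile_le (K : ℕ) (a : ℝ) (ha1 : a < 1) :
    a ≤ chiCDF K (chiQuantile K a) := by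
  have hp : IsProbabilityMeasure (Measure.map (fun x : Fin K → ℝ => Real.sqrt (∑ k, x k ^ 2)) (g1 K)) :=
    Measure.isProbabilityMeasure_map (meas_nrm K).aemeasurable
  set S := {t : ℝ | a ≤ chiCDF K t} with hS
  have hne : S.Nonempty := by
    have := (tendsto_cdf_atTop (Measure.map (fun x : Fin K → ℝ => Real.sqrt (∑ k, x k ^ 2)) (g1 K))).eventually
      (lt_mem_nhds ha1)
    obtain ⟨t, ht⟩ := this.exists
    exact ⟨t, by rw [hS, Set.mem_ofPred_eq, chiCDF_eq_cdf]; exact ht.le⟩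
  have key : ∀ t, chiQuantile K a < t → a ≤ chiCDF K t := by
    intro t ht
    obtain ⟨u, hu, hut⟩ := exists_lt_of_csInf_lt hne ht
    exact le_trans hu (chiCDF_mono K hut.le)
  have hc := (cdf (Measure.map (fun x : Fin K → ℝ => Real.sqrt (∑ k, x k ^ 2)) (g1 K))).right_continuous
    (chiQuantile K a)
  rw [chiCDF_eq_cdf]
  have hc' := hc.tendsto.mono_left (nhdsWithin_mono _ Set.Ioi_subset_Ici_self)
  refine ge_of_tendsto hc' ?_
  filter_upwards [self_mem_nhdsWithin] with t ht
  rw [← chiCDF_eq_cdf]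
  exact key t ht

lemma chi_upper_eq (K : ℕ) (t : ℝ) :
    (g1 K).real {x | t < Real.sqrt (∑ k, x k ^ 2)} = 1 - chiCDF K t := by
  have h : {x : Fin K → ℝ | t < Real.sqrt (∑ k, x k ^ 2)} = {x | Real.sqrt (∑ k, x k ^ 2) ≤ t}ᶜ := by
    ext x; simp
  rw [h, probReal_compl_eq_one_sub (measurableSet_le (meas_nrm K) measurable_const)]
  rfl

lemma chi_tail_lower (K : ℕ) (hK : 1 ≤ K) (x δ : ℝ) (hx : 0 ≤ x) (hδ : 0 < δ) :
    δ * ((√(2 * Real.pi))⁻¹ * Real.exp (-(x + δ) ^ 2 / 2)) ≤ 1 - chiCDF K x := by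
  rw [← chi_upper_eq]
  have h1 : (gaussianReal 0 1).real (Set.Ioc x (x + δ)) ≤
      (g1 K).real {y | x < Real.sqrt (∑ k, y k ^ 2)} := by
    have := (measurePreserving_eval (fun _ : Fin K => gaussianReal 0 1) ⟨0, hK⟩)
    rw [measureReal_def, measureReal_def, ← this.measure_preimage measurableSet_Ioc.nullMeasurableSet]
    refine ENNReal.toReal_mono (measure_ne_top _ _) (measure_mono ?_)
    intro y hy
    simp only [Set.mem_preimage, Function.eval, Set.mem_Ioc] at hy
    simp only [Set.mem_ofPred_eq]
    refine hy.1.trans_le ?_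
    refine Real.le_sqrt_of_sq_le ?_
    exact Finset.single_le_sum (f := fun k => y k ^ 2) (fun k _ => sq_nonneg _) (Finset.mem_univ _)
  refine le_trans ?_ h1
  rw [measureReal_def, gaussianReal_apply_eq_integral _ one_ne_zero, ENNReal.toReal_ofReal
    (by exact setIntegral_nonneg measurableSet_Ioc fun _ _ => gaussianPDFReal_nonneg _ _ _)]
  have : δ * ((√(2 * Real.pi))⁻¹ * Real.exp (-(x + δ) ^ 2 / 2)) =
      ∫ y in Set.Ioc x (x + δ), (√(2 * Real.pi))⁻¹ * Real.exp (-(x + δ) ^ 2 / 2) := by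
    rw [setIntegral_const]
    simp [hδ.le]
  rw [this]
  refine setIntegral_mono_on (integrableOn_const (by simp)) (integrable_gaussianPDFReal 0 1).integrableOn
    measurableSet_Ioc ?_
  intro y hy
  rw [gaussianPDFReal]
  simp only [NNReal.coe_one, mul_one, sub_zero]
  gcongr
  · exact hx.trans hy.1.le
  · exact hy.2

lemma gauss_sq_mgf (c : ℝ) (hc : 0 < c) :
    Integrable (fun x => Real.exp ((1 - (c ^ 2)⁻¹) * x ^ 2 / 2)) (gaussianReal 0 1) ∧
    ∫ x, Real.exp ((1 - (c ^ 2)⁻¹) * x ^ 2 / 2) ∂(gaussianReal 0 1) = c := by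
  have he : ∀ x : ℝ, gaussianPDFReal 0 1 x * Real.exp ((1 - (c ^ 2)⁻¹) * x ^ 2 / 2) =
      (√(2 * Real.pi))⁻¹ * Real.exp (-((2 * c ^ 2)⁻¹) * x ^ 2) := by
    intro x
    rw [gaussianPDFReal]
    simp only [NNReal.coe_one, mul_one, sub_zero]
    rw [mul_assoc, ← Real.exp_add]
    congr 2
    field_simp
    ring
  have hI : ∫ x, Real.exp ((1 - (c ^ 2)⁻¹) * x ^ 2 / 2) ∂(gaussianReal 0 1) = c := by
    rw [integral_gaussianReal_eq_integral_smul one_ne_zero]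
    simp only [smul_eq_mul, he]
    rw [integral_const_mul, integral_gaussian]
    rw [div_inv_eq_mul, show Real.pi * (2 * c ^ 2) = (2 * Real.pi) * c ^ 2 by ring,
      Real.sqrt_mul (x := 2 * Real.pi) (by positivity), Real.sqrt_sq hc.le]
    field_simp
  refine ⟨?_, hI⟩
  by_contra h
  rw [integral_undef h] at hI
  exact hc.ne hI

lemma fip_le {m n : ℕ} (A B : Matrix (Fin m) (Fin n) ℝ) :
    fip A B ≤ √(frobSq A) * √(frobSq B) := by
  simp only [fip, frobSq]
  simp_rw [← Finset.sum_product', Finset.univ_product_univ]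
  exact Real.sum_mul_le_sqrt_mul_sqrt _ _ _

lemma frobSq_nonneg {m n : ℕ} (A : Matrix (Fin m) (Fin n) ℝ) : 0 ≤ frobSq A := by
  unfold frobSq; positivity

lemma frobSq_self {m n : ℕ} (A : Matrix (Fin m) (Fin n) ℝ) : fip A A = frobSq A := by
  simp [fip, frobSq, sq]

lemma frobSq_mul_orth_le {p d K : ℕ} (H : Matrix (Fin d) (Fin K) ℝ) (hH : Hᵀ * H = 1)
    (A : Matrix (Fin p) (Fin d) ℝ) : frobSq (A * H) ≤ frobSq A := by
  have h1 : frobSq (A * H) ≤ √(frobSq (A * H)) * √(frobSq A) := by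
    conv_lhs => rw [← frobSq_self, fip_mul_right]
    refine (fip_le _ _).trans ?_
    rw [frobSq_mul_right H hH]
  set a := √(frobSq (A * H)) with ha
  set b := √(frobSq A) with hb
  have ha2 : a ^ 2 = frobSq (A * H) := Real.sq_sqrt (frobSq_nonneg _)
  have hb2 : b ^ 2 = frobSq A := Real.sq_sqrt (frobSq_nonneg _)
  rw [← ha2, ← hb2]
  rw [← ha2] at h1
  have hb0 : 0 ≤ b := Real.sqrt_nonneg _
  have ha0 : 0 ≤ a := Real.sqrt_nonneg _
  nlinarith [sq_nonneg (a - b)]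

lemma row_orth_le {d K : ℕ} (H : Matrix (Fin d) (Fin K) ℝ) (hH : Hᵀ * H = 1)
    {p : ℕ} (Z : Matrix (Fin p) (Fin d) ℝ) (i : Fin p) :
    √(∑ k, (Z * H) i k ^ 2) ≤ √(∑ l, Z i l ^ 2) := by
  refine Real.sqrt_le_sqrt ?_
  have := frobSq_mul_orth_le H hH (Matrix.of fun (_ : Fin 1) l => Z i l)
  simpa [frobSq, Matrix.mul_apply] using this

lemma frobSq_mul_le {p d K : ℕ} (A : Matrix (Fin p) (Fin d) ℝ) (B : Matrix (Fin d) (Fin K) ℝ) :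
    frobSq (A * B) ≤ frobSq A * frobSq B := by
  rw [← frobSq_transpose B]
  simp only [frobSq, Matrix.mul_apply, Matrix.transpose_apply]
  rw [Finset.sum_mul_sum]
  refine Finset.sum_le_sum fun i _ => Finset.sum_le_sum fun k _ => ?_
  exact Finset.sum_mul_sq_le_sq_mul_sq _ _ _

lemma rowNorms_sq_sum {p K : ℕ} (G : Matrix (Fin p) (Fin K) ℝ) :
    ∑ i, rowNorms G i ^ 2 = frobSq G := by
  unfold rowNorms frobSq
  refine Finset.sum_congr rfl fun i _ => Real.sq_sqrt (by positivity)

lemma fip_le_rows {p K : ℕ} (A G : Matrix (Fin p) (Fin K) ℝ) :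
    fip A G ≤ ∑ i, √(∑ k, A i k ^ 2) * rowNorms G i :=
  Finset.sum_le_sum fun i _ => Real.sum_mul_le_sqrt_mul_sqrt _ _ _

lemma orth_entry {d K : ℕ} (H : Matrix (Fin d) (Fin K) ℝ) (hH : Hᵀ * H = 1) (i : Fin d) (k : Fin K) :
    |H i k| ≤ 1 := by
  have h := congrFun (congrFun hH k) k
  simp only [Matrix.mul_apply, Matrix.transpose_apply, Matrix.one_apply_eq] at h
  have h2 := Finset.single_le_sum (f := fun i => H i k * H i k) (fun i _ => mul_self_nonneg _)
    (Finset.mem_univ i)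
  rw [← sq_le_one_iff_abs_le_one, sq]
  linarith

open Classical in
lemma exists_net (d K N : ℕ) (hN : 0 < N) :
    ∃ T : Finset (Matrix (Fin d) (Fin K) ℝ), T.card ≤ (2 * N + 1) ^ (d * K) ∧
      (∀ H ∈ T, Hᵀ * H = 1) ∧
      ∀ H : Matrix (Fin d) (Fin K) ℝ, Hᵀ * H = 1 → ∃ H' ∈ T, ∀ i k, |H i k - H' i k| ≤ 1 / (N : ℝ) := by
  let cell : Matrix (Fin d) (Fin K) ℝ → (Fin d → Fin K → ℤ) := fun H i k => ⌊(N:ℝ) * H i k⌋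
  let C : Finset (Fin d → Fin K → ℤ) := Fintype.piFinset fun _ => Fintype.piFinset fun _ =>
    Finset.Icc (-(N:ℤ)) N
  let P : (Fin d → Fin K → ℤ) → Prop := fun c => ∃ H : Matrix (Fin d) (Fin K) ℝ, Hᵀ * H = 1 ∧ cell H = c
  let rep : (Fin d → Fin K → ℤ) → Matrix (Fin d) (Fin K) ℝ := fun c =>
    if h : P c then h.choose else 0
  have hrep : ∀ c, P c → (rep c)ᵀ * rep c = 1 ∧ cell (rep c) = c := by
    intro c hc
    simp only [rep, dif_pos hc]
    exact hc.choose_spec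
  refine ⟨(C.filter P).image rep, ?_, ?_, ?_⟩
  · refine Finset.card_image_le.trans ((Finset.card_filter_le _ _).trans ?_)
    simp only [C, Fintype.card_piFinset, Int.card_Icc, Finset.prod_const, Finset.card_univ,
      Fintype.card_fin]
    rw [← pow_mul, mul_comm d K]
    refine Nat.pow_le_pow_left ?_ _
    omega
  · intro H hH
    obtain ⟨c, hc, rfl⟩ := Finset.mem_image.1 hH
    exact (hrep c (Finset.mem_filter.1 hc).2).1
  · intro H hH
    have hP : P (cell H) := ⟨H, hH, rfl⟩
    have hNp : (0:ℝ) < N := by exact_mod_cast hN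
    refine ⟨rep (cell H), Finset.mem_image.2 ⟨cell H, Finset.mem_filter.2 ⟨?_, hP⟩, rfl⟩, ?_⟩
    · simp only [C, Fintype.mem_piFinset, Finset.mem_Icc]
      intro i k
      have := abs_le.1 (orth_entry H hH i k)
      constructor
      · refine Int.le_floor.2 ?_
        push_cast
        nlinarith
      · have : (⌊(N:ℝ) * H i k⌋ : ℝ) ≤ N := (Int.floor_le _).trans (by nlinarith)
        exact_mod_cast this
    · intro i k
      have h := congrFun (congrFun (hrep _ hP).2 i) k
      simp only [cell] at h
      have h1 := Int.abs_sub_lt_one_of_floor_eq_floor h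
      rw [← mul_sub, abs_mul, abs_of_pos hNp, abs_sub_comm] at h1
      rw [le_div_iff₀ hNp, mul_comm]
      exact h1.le

lemma count_tail (p K k : ℕ) (hp : 0 < p) (q x : ℝ) (hq0 : 0 < q) (hq1 : q < 1)
    (hx : 1 - chiCDF K x ≤ q * k / p) :
    (gm p K 1).real {Z | k ≤ (Finset.univ.filter fun i => x < √(∑ l, Z i l ^ 2)).card} ≤
      (q * Real.exp (1 - q)) ^ k := by
  set f : (Fin K → ℝ) → ℝ := fun z => 1 + Set.indicator {z | x < √(∑ l, z l ^ 2)} (fun _ => 1 / q - 1) z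
    with hf
  have hms : MeasurableSet {z : Fin K → ℝ | x < √(∑ l, z l ^ 2)} :=
    measurableSet_lt measurable_const (meas_nrm K)
  have hint : Integrable (Set.indicator {z : Fin K → ℝ | x < √(∑ l, z l ^ 2)} (fun _ => 1 / q - 1)) (g1 K) :=
    (integrable_const _).indicator hms
  have hfi : Integrable f (g1 K) := (integrable_const _).add hint
  have hq' : 0 ≤ 1 / q - 1 := by
    rw [sub_nonneg, le_div_iff₀ hq0]; linarith
  have hfv : ∫ z, f z ∂(g1 K) ≤ Real.exp ((1 - q) * k / p) := by
    rw [hf, integral_add (integrable_const _) hint, integral_indicator_const _ hms, chi_upper_eq]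
    simp only [integral_const, probReal_univ, smul_eq_mul]
    have h1 : (1 - chiCDF K x) * (1 / q - 1) ≤ q * k / p * (1 / q - 1) :=
      mul_le_mul_of_nonneg_right hx hq'
    have h2 : q * k / p * (1 / q - 1) = (1 - q) * k / p := by field_simp
    have := Real.add_one_le_exp ((1 - q) * k / p)
    linarith
  have hf1 : ∀ z, f z = if x < √(∑ l, z l ^ 2) then 1 / q else 1 := by
    intro z
    simp only [hf, Set.indicator_apply, Set.mem_ofPred_eq]
    split_ifs <;> ring
  have hprodi : Integrable (fun Z : Fin p → Fin K → ℝ => ∏ i, f (Z i)) (gm p K 1) :=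
    Integrable.fintype_prod (μ := fun _ : Fin p => g1 K) (f := fun _ => f) fun _ => hfi
  have hpv : ∫ Z, ∏ i, f (Z i) ∂(gm p K 1) ≤ Real.exp ((1 - q) * k) := by
    have := integral_fintype_prod_eq_pow (ι := Fin p) f (μ := g1 K)
    rw [this, Fintype.card_fin]
    have h0 : 0 ≤ ∫ z, f z ∂(g1 K) := integral_nonneg fun z => by
      rw [hf1]; dsimp only; split_ifs <;> positivity
    refine (pow_le_pow_left₀ h0 hfv p).trans (le_of_eq ?_)
    rw [← Real.exp_nat_mul]
    congr 1
    field_simp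
  have hmS : MeasurableSet {Z : Fin p → Fin K → ℝ | k ≤ (Finset.univ.filter fun i => x < √(∑ l, Z i l ^ 2)).card} := by
    have : Measurable fun Z : Fin p → Fin K → ℝ => (Finset.univ.filter fun i => x < √(∑ l, Z i l ^ 2)).card := by
      simp_rw [Finset.card_filter]
      refine Finset.measurable_sum _ fun i _ => ?_
      refine Measurable.ite ?_ measurable_const measurable_const
      exact measurableSet_lt measurable_const (by fun_prop)
    exact this measurableSet_Ici
  have hpt : ∀ Z : Fin p → Fin K → ℝ,
      Set.indicator {Z | k ≤ (Finset.univ.filter fun i => x < √(∑ l, Z i l ^ 2)).card} (fun _ => (1:ℝ)) Z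
        ≤ q ^ k * ∏ i, f (Z i) := by
    intro Z
    have hpr : ∏ i, f (Z i) = (1 / q) ^ (Finset.univ.filter fun i => x < √(∑ l, Z i l ^ 2)).card := by
      simp_rw [hf1]
      rw [Finset.prod_ite]
      simp
    rw [hpr, Set.indicator_apply]
    split_ifs with h
    · have h2 : (1 / q) ^ k ≤ (1 / q) ^ (Finset.univ.filter fun i => x < √(∑ l, Z i l ^ 2)).card :=
        pow_le_pow_right₀ (by linarith) h
      calc (1:ℝ) = q ^ k * (1 / q) ^ k := by rw [← mul_pow]; simp [hq0.ne']
        _ ≤ _ := by gcongr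
    · positivity
  have := integral_mono ((integrable_const (1:ℝ)).indicator hmS) (hprodi.const_mul (q ^ k)) hpt
  rw [integral_indicator_const _ hmS, integral_const_mul] at this
  simp only [smul_eq_mul, mul_one] at this
  refine this.trans ?_
  rw [mul_pow, ← Real.exp_nat_mul, mul_comm (k:ℝ)]
  gcongr

lemma excess_bound (d : ℕ) (c : ℝ) (hc0 : 0 < c) (hc : 2 ≤ c ^ 2) :
    Integrable (fun z : Fin d → ℝ => (max (√(∑ l, z l ^ 2) - c) 0) ^ 2) (g1 d) ∧
    ∫ z, (max (√(∑ l, z l ^ 2) - c) 0) ^ 2 ∂(g1 d) ≤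
      4 * Real.exp (1 / 2) * Real.exp (-c ^ 2 / 2) * c ^ d := by
  obtain ⟨hi, hv⟩ := gauss_sq_mgf c hc0
  set θ := 1 - (c ^ 2)⁻¹ with hθ
  have hθ2 : 1 / 2 ≤ θ := by
    have : (c ^ 2)⁻¹ ≤ 2⁻¹ := inv_anti₀ (by norm_num) hc
    rw [hθ]; linarith
  have hI : Integrable (fun z : Fin d → ℝ => ∏ l, Real.exp (θ * z l ^ 2 / 2)) (g1 d) :=
    Integrable.fintype_prod (μ := fun _ : Fin d => gaussianReal 0 1)
      (f := fun _ x => Real.exp (θ * x ^ 2 / 2)) fun _ => hi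
  have hV : ∫ z, ∏ l, Real.exp (θ * z l ^ 2 / 2) ∂(g1 d) = c ^ d := by
    have := integral_fintype_prod_eq_pow (ι := Fin d) (fun x : ℝ => Real.exp (θ * x ^ 2 / 2))
      (μ := gaussianReal 0 1)
    rw [this, hv, Fintype.card_fin]
  have hpt : ∀ z : Fin d → ℝ, (max (√(∑ l, z l ^ 2) - c) 0) ^ 2 ≤
      4 * Real.exp (1 / 2) * Real.exp (-c ^ 2 / 2) * ∏ l, Real.exp (θ * z l ^ 2 / 2) := by
    intro z
    have hprod : ∏ l, Real.exp (θ * z l ^ 2 / 2) = Real.exp (θ * (√(∑ l, z l ^ 2)) ^ 2 / 2) := by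
      rw [← Real.exp_sum, Real.sq_sqrt (by positivity), Finset.mul_sum, Finset.sum_div]
    rw [hprod]
    set y := √(∑ l, z l ^ 2) with hy
    have hy0 : 0 ≤ y := Real.sqrt_nonneg _
    rcases le_or_gt y c with h | h
    · rw [max_eq_right (by linarith), zero_pow two_ne_zero]
      positivity
    · rw [max_eq_left (by linarith)]
      have hE : 4 * Real.exp (1 / 2) * Real.exp (-c ^ 2 / 2) * Real.exp (θ * y ^ 2 / 2) =
          4 * Real.exp (θ * (y ^ 2 - c ^ 2) / 2) := by
        rw [mul_assoc, mul_assoc, ← Real.exp_add, ← Real.exp_add]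
        congr 2
        rw [hθ]
        field_simp
        ring
      rw [hE]
      have h1 := Real.add_one_le_exp (θ * (y ^ 2 - c ^ 2) / 2)
      have h2 : (y - c) ^ 2 ≤ y ^ 2 - c ^ 2 := by nlinarith
      have h3 : 1 / 2 * (y - c) ^ 2 ≤ θ * (y ^ 2 - c ^ 2) := by
        have := sq_nonneg (y - c)
        nlinarith
      linarith
  have hI' := hI.const_mul (4 * Real.exp (1 / 2) * Real.exp (-c ^ 2 / 2))
  have hint : Integrable (fun z : Fin d → ℝ => (max (√(∑ l, z l ^ 2) - c) 0) ^ 2) (g1 d) := by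
    refine hI'.mono' (Measurable.aestronglyMeasurable (by fun_prop)) (ae_of_all _ fun z => ?_)
    rw [Real.norm_of_nonneg (by positivity)]
    exact hpt z
  refine ⟨hint, ?_⟩
  refine (integral_mono hint hI' hpt).trans ?_
  rw [integral_const_mul, hV]

lemma excess_sum (p d : ℕ) (c : ℝ) (hc0 : 0 < c) (hc : 2 ≤ c ^ 2) :
    Integrable (fun Z : Fin p → Fin d → ℝ => ∑ i, (max (√(∑ l, Z i l ^ 2) - c) 0) ^ 2) (gm p d 1) ∧
    ∫ Z, ∑ i, (max (√(∑ l, Z i l ^ 2) - c) 0) ^ 2 ∂(gm p d 1) ≤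
      p * (4 * Real.exp (1 / 2) * Real.exp (-c ^ 2 / 2) * c ^ d) := by
  obtain ⟨hi, hv⟩ := excess_bound d c hc0 hc
  have hI : ∀ i : Fin p, Integrable (fun Z : Fin p → Fin d → ℝ => (max (√(∑ l, Z i l ^ 2) - c) 0) ^ 2) (gm p d 1) :=
    fun i => integrable_comp_eval (μ := fun _ : Fin p => g1 d) (i := i) hi
  refine ⟨integrable_finsetSum _ fun i _ => hI i, ?_⟩
  rw [integral_finsetSum _ fun i _ => hI i]
  have : ∀ i ∈ (Finset.univ : Finset (Fin p)), ∫ Z, (max (√(∑ l, Z i l ^ 2) - c) 0) ^ 2 ∂(gm p d 1) ≤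
      (4 * Real.exp (1 / 2) * Real.exp (-c ^ 2 / 2) * c ^ d) := by
    intro i _
    refine le_trans (le_of_eq ?_) hv
    exact integral_comp_eval (μ := fun _ : Fin p => g1 d) (i := i) hi.aestronglyMeasurable
  refine (Finset.sum_le_sum this).trans ?_
  simp

lemma fourth_moment (d : ℕ) : ∃ M : ℝ, 0 ≤ M ∧ ∀ p : ℕ,
    Integrable (fun Z : Fin p → Fin d → ℝ => (frobSq (Matrix.of Z)) ^ 2) (gm p d 1) ∧
    ∫ Z, (frobSq (Matrix.of Z)) ^ 2 ∂(gm p d 1) ≤ M * p ^ 2 := by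
  have h4 : Integrable (fun x : ℝ => x ^ 4) (gaussianReal 0 1) := by
    have := (memLp_id_gaussianReal (μ := 0) (v := 1) 4).integrable_norm_pow (by norm_num)
    refine this.congr (ae_of_all _ fun x => ?_)
    simp [Even.pow_abs (show Even 4 by decide)]
  set m4 := ∫ x, x ^ 4 ∂(gaussianReal 0 1)
  have hm4 : 0 ≤ m4 := integral_nonneg fun x => by positivity
  refine ⟨d ^ 2 * m4, by positivity, fun p => ?_⟩
  have hr : ∀ l : Fin d, Integrable (fun z : Fin d → ℝ => z l ^ 4) (g1 d) :=
    fun l => integrable_comp_eval (μ := fun _ : Fin d => gaussianReal 0 1) (i := l) h4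
  have hZ : ∀ (i : Fin p) (l : Fin d), Integrable (fun Z : Fin p → Fin d → ℝ => Z i l ^ 4) (gm p d 1) :=
    fun i l => integrable_comp_eval (μ := fun _ : Fin p => g1 d) (i := i) (hr l)
  have hZv : ∀ (i : Fin p) (l : Fin d), ∫ Z, Z i l ^ 4 ∂(gm p d 1) = m4 := by
    intro i l
    refine (integral_comp_eval (μ := fun _ : Fin p => g1 d) (i := i)
      (f := fun z => z l ^ 4) (hr l).aestronglyMeasurable).trans ?_
    exact integral_comp_eval (μ := fun _ : Fin d => gaussianReal 0 1) (i := l) (f := fun x => x ^ 4)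
      h4.aestronglyMeasurable
  have hpt : ∀ Z : Fin p → Fin d → ℝ, (frobSq (Matrix.of Z)) ^ 2 ≤ (p * d : ℝ) * ∑ i, ∑ l, Z i l ^ 4 := by
    intro Z
    simp only [frobSq, Matrix.of_apply]
    refine (sq_sum_le_card_mul_sum_sq).trans ?_
    rw [Finset.card_univ, Fintype.card_fin, mul_assoc]
    refine mul_le_mul_of_nonneg_left ?_ (by positivity)
    rw [Finset.mul_sum]
    refine Finset.sum_le_sum fun i _ => ?_
    refine (sq_sum_le_card_mul_sum_sq).trans ?_
    rw [Finset.card_univ, Fintype.card_fin]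
    refine le_of_eq ?_
    congr 1
    exact Finset.sum_congr rfl fun l _ => by ring
  have hI : Integrable (fun Z : Fin p → Fin d → ℝ => (p * d : ℝ) * ∑ i, ∑ l, Z i l ^ 4) (gm p d 1) :=
    (integrable_finsetSum _ fun i _ => integrable_finsetSum _ fun l _ => hZ i l).const_mul _
  have hI2 : Integrable (fun Z : Fin p → Fin d → ℝ => (frobSq (Matrix.of Z)) ^ 2) (gm p d 1) := by
    refine hI.mono' ?_ (ae_of_all _ fun Z => ?_)
    · simp only [frobSq, Matrix.of_apply]
      exact Measurable.aestronglyMeasurable (by fun_prop)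
    · rw [Real.norm_of_nonneg (by positivity)]
      exact hpt Z
  refine ⟨hI2, (integral_mono hI2 hI hpt).trans ?_⟩
  rw [integral_const_mul, integral_finsetSum _ fun i _ => integrable_finsetSum _ fun l _ => hZ i l]
  simp_rw [integral_finsetSum _ fun l _ => hZ _ l, hZv]
  simp only [Finset.sum_const, Finset.card_univ, Fintype.card_fin, nsmul_eq_mul]
  refine le_of_eq ?_
  ring

lemma chi_quantile_nonneg (K : ℕ) (a : ℝ) (ha : 0 < a) : 0 ≤ chiQuantile K a := by
  refine Real.sInf_nonneg fun t ht => ?_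
  by_contra! hlt
  have h0 : chiCDF K t = 0 := by
    have : {x : Fin K → ℝ | Real.sqrt (∑ k, x k ^ 2) ≤ t} = ∅ := by
      ext x
      simp only [Set.mem_ofPred_eq, Set.mem_empty_iff_false, iff_false, not_le]
      exact hlt.trans_le (Real.sqrt_nonneg _)
    simp [chiCDF, this]
  have : a ≤ chiCDF K t := ht
  linarith

set_option maxHeartbeats 2000000 in
lemma fixed_p (p K d m : ℕ) (hp : 0 < p) (q δ l M : ℝ) (hq0 : 0 < q) (hq1 : q < 1) (hδ : 0 < δ)
    (hl : 0 < l) (hc : 2 ≤ (l + δ) ^ 2) (hr : q * Real.exp (1 - q) ≤ 1)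
    (hM : Integrable (fun Z : Fin p → Fin d → ℝ => (frobSq (Matrix.of Z)) ^ 2) (gm p d 1) ∧
      ∫ Z, (frobSq (Matrix.of Z)) ^ 2 ∂(gm p d 1) ≤ M * p ^ 2)
    (hQ : ∀ j : Fin p, j.val < m → l - 2 * δ ≤ chiQuantile K (1 - q * ((j : ℕ) + 1) / (p : ℝ))) :
    ∃ R : (Fin p → Fin d → ℝ) → ℝ, (∀ Z, 0 ≤ R Z) ∧ Integrable R (gm p d 1) ∧
      ∫ Z, R Z ∂(gm p d 1) ≤ 36 * m * δ ^ 2 +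
        4 * m * (p * (4 * Real.exp (1 / 2) * Real.exp (-(l + δ) ^ 2 / 2) * (l + δ) ^ d)) +
        2 * d * K * (1 + M) + M +
        p ^ 2 * ((2 * p + 1) ^ (d * K) * p * (q * Real.exp (1 - q)) ^ m) ∧
      ∀ (Z : Fin p → Fin d → ℝ) (H : Matrix (Fin d) (Fin K) ℝ) (G : Matrix (Fin p) (Fin K) ℝ),
        Hᵀ * H = 1 → fip (Matrix.of Z) (G * Hᵀ) ≤
          slopePen (fun j => chiQuantile K (1 - q * ((j : ℕ) + 1) / (p : ℝ))) (rowNorms G) +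
            √(R Z) * √(frobSq G) := by
  obtain ⟨T, hTc, hTo, hTn⟩ := exists_net d K p hp
  have hpp : (0:ℝ) < p := by exact_mod_cast hp
  set Q : Fin p → ℝ := fun j => chiQuantile K (1 - q * ((j : ℕ) + 1) / (p : ℝ)) with hQdef
  let B : Matrix (Fin d) (Fin K) ℝ → Fin p → Set (Fin p → Fin d → ℝ) := fun H j =>
    {Z | j.val + 1 ≤ (Finset.univ.filter fun i => Q j < √(∑ k, (Matrix.of Z * H) i k ^ 2)).card}
  let J : Finset (Fin p) := Finset.univ.filter fun j => m ≤ j.val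
  let Bad : Set (Fin p → Fin d → ℝ) := ⋃ H ∈ T, ⋃ j ∈ J, B H j
  have hr0 : 0 < q * Real.exp (1 - q) := by positivity
  have hBm : ∀ H j, MeasurableSet (B H j) := by
    intro H j
    have : Measurable fun Z : Fin p → Fin d → ℝ =>
        (Finset.univ.filter fun i => Q j < √(∑ k, (Matrix.of Z * H) i k ^ 2)).card := by
      simp_rw [Finset.card_filter]
      refine Finset.measurable_sum _ fun i _ => ?_
      refine Measurable.ite ?_ measurable_const measurable_const
      refine measurableSet_lt measurable_const ?_
      simp only [Matrix.mul_apply, Matrix.of_apply]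
      fun_prop
    exact this measurableSet_Ici
  have hBadm : MeasurableSet Bad := Finset.measurableSet_biUnion _ fun H _ =>
    Finset.measurableSet_biUnion _ fun j _ => hBm H j
  have hBv : ∀ H ∈ T, ∀ j ∈ J, (gm p d 1).real (B H j) ≤ (q * Real.exp (1 - q)) ^ m := by
    intro H hH j hj
    have hj' : m ≤ j.val := (Finset.mem_filter.1 hj).2
    have hlaw := gm_law p d p K 1 1 1 (by simp) (1 : Matrix (Fin p) (Fin p) ℝ) (by simp) H (hTo H hH)
    simp only [Matrix.transpose_one, Matrix.one_mul, one_mul] at hlaw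
    have hmeas : Measurable fun E : Fin p → Fin d → ℝ => fun i k => (Matrix.of E * H) i k := by
      refine measurable_pi_lambda _ fun i => measurable_pi_lambda _ fun k => ?_
      simp only [Matrix.mul_apply, Matrix.of_apply]
      fun_prop
    have hx : 1 - chiCDF K (Q j) ≤ q * ((j.val + 1 : ℕ) : ℝ) / p := by
      have := chi_quantile_le K (1 - q * ((j : ℕ) + 1) / (p : ℝ)) (by
        have : 0 < q * ((j : ℕ) + 1) / (p : ℝ) := by positivity
        linarith)
      push_cast
      simp only [hQdef]
      linarith
    have hct := count_tail p K (j.val + 1) hp q (Q j) hq0 hq1 hx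
    have hmS : MeasurableSet {Z : Fin p → Fin K → ℝ | j.val + 1 ≤ (Finset.univ.filter fun i => Q j < √(∑ l, Z i l ^ 2)).card} := by
      have : Measurable fun Z : Fin p → Fin K → ℝ => (Finset.univ.filter fun i => Q j < √(∑ l, Z i l ^ 2)).card := by
        simp_rw [Finset.card_filter]
        refine Finset.measurable_sum _ fun i _ => ?_
        refine Measurable.ite ?_ measurable_const measurable_const
        exact measurableSet_lt measurable_const (by fun_prop)
      exact this measurableSet_Ici
    rw [← hlaw, measureReal_def, Measure.map_apply hmeas hmS] at hct
    refine le_trans hct (pow_le_pow_of_le_one hr0.le hr (by omega))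
  have hBadv : (gm p d 1).real Bad ≤ (2 * p + 1) ^ (d * K) * p * (q * Real.exp (1 - q)) ^ m := by
    have h1 : ∀ H ∈ T, (gm p d 1).real (⋃ j ∈ J, B H j) ≤ p * (q * Real.exp (1 - q)) ^ m := by
      intro H hH
      refine (measureReal_biUnion_finset_le _ _).trans ?_
      refine (Finset.sum_le_sum (hBv H hH)).trans ?_
      rw [Finset.sum_const, nsmul_eq_mul]
      gcongr
      exact (Finset.card_filter_le _ _).trans (by simp)
    refine (measureReal_biUnion_finset_le _ _).trans ?_
    refine (Finset.sum_le_sum h1).trans ?_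
    rw [Finset.sum_const, nsmul_eq_mul, mul_assoc]
    gcongr
    exact_mod_cast hTc
  obtain ⟨hAi, hAv⟩ := excess_sum p d (l + δ) (by positivity) hc
  set A : (Fin p → Fin d → ℝ) → ℝ := fun Z => ∑ i, (max (√(∑ l, Z i l ^ 2) - (l + δ)) 0) ^ 2 with hA
  have hA0 : ∀ Z, 0 ≤ A Z := fun Z => Finset.sum_nonneg fun i _ => sq_nonneg _
  let R : (Fin p → Fin d → ℝ) → ℝ := fun Z =>
    36 * m * δ ^ 2 + 4 * m * A Z + 2 * d * K * (1 + (frobSq (Matrix.of Z)) ^ 2 / p ^ 2)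
      + (frobSq (Matrix.of Z)) ^ 2 / p ^ 2 + p ^ 2 * Bad.indicator (fun _ => (1:ℝ)) Z
  have hRZ : ∀ Z, R Z = 36 * m * δ ^ 2 + 4 * m * A Z +
      2 * d * K * (1 + (frobSq (Matrix.of Z)) ^ 2 / p ^ 2)
      + (frobSq (Matrix.of Z)) ^ 2 / p ^ 2 + p ^ 2 * Bad.indicator (fun _ => (1:ℝ)) Z :=
    fun Z => rfl
  have hind0 : ∀ Z, 0 ≤ Bad.indicator (fun _ => (1:ℝ)) Z :=
    fun Z => Set.indicator_nonneg (fun _ _ => zero_le_one) Z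
  have hR0 : ∀ Z, 0 ≤ R Z := by
    intro Z
    have := hA0 Z
    have := hind0 Z
    positivity
  have i1 : Integrable (fun _ : Fin p → Fin d → ℝ => 36 * m * δ ^ 2) (gm p d 1) := integrable_const _
  have i2 := hAi.const_mul (4 * m : ℝ)
  have i4 := hM.1.div_const ((p:ℝ) ^ 2)
  have i3 := ((integrable_const (1:ℝ)).add i4).const_mul (2 * d * K : ℝ)
  have i5 := ((integrable_const (μ := gm p d 1) (1:ℝ)).indicator hBadm).const_mul ((p:ℝ) ^ 2)
  have i12 := i1.add i2
  have i123 := i12.add i3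
  have i1234 := i123.add i4
  have hRi : Integrable R (gm p d 1) := i1234.add i5
  have hMv : (∫ Z, (frobSq (Matrix.of Z)) ^ 2 ∂(gm p d 1)) / p ^ 2 ≤ M := by
    rw [div_le_iff₀ (by positivity)]; exact hM.2
  refine ⟨R, hR0, hRi, ?_, ?_⟩
  · have e1 : ∫ Z, R Z ∂(gm p d 1) = 36 * m * δ ^ 2 + 4 * m * (∫ Z, A Z ∂(gm p d 1)) +
        2 * d * K * (1 + (∫ Z, (frobSq (Matrix.of Z)) ^ 2 ∂(gm p d 1)) / p ^ 2) +
        (∫ Z, (frobSq (Matrix.of Z)) ^ 2 ∂(gm p d 1)) / p ^ 2 +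
        p ^ 2 * (gm p d 1).real Bad := by
      refine (integral_add i1234 i5).trans ?_
      congr 1
      · refine (integral_add i123 i4).trans ?_
        congr 1
        · refine (integral_add i12 i3).trans ?_
          congr 1
          · refine (integral_add i1 i2).trans ?_
            congr 1
            · simp
            · exact integral_const_mul _ _
          · refine (integral_const_mul _ _).trans ?_
            congr 1
            refine (integral_add (integrable_const _) i4).trans ?_
            congr 1
            · simp
            · exact integral_div _ _
        · exact integral_div _ _
      · refine (integral_const_mul _ _).trans ?_
        rw [integral_indicator_const _ hBadm]
        simp
    rw [e1]
    gcongr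
  · intro Z H G hH
    set F := frobSq (Matrix.of Z) with hF
    have hF0 : 0 ≤ F := frobSq_nonneg _
    have hFp0 : 0 ≤ F ^ 2 / (p:ℝ) ^ 2 := by positivity
    have hAZ := hA0 Z
    have hFp : F / p ^ 2 ≤ 1 + F ^ 2 / p ^ 2 := by
      have h1 : (1:ℝ) ≤ p := by exact_mod_cast hp
      rw [div_le_iff₀ (by positivity), add_mul, div_mul_cancel₀ _ (by positivity)]
      nlinarith [sq_nonneg (F - 1)]
    by_cases hb : Z ∈ Bad
    · have hpen : 0 ≤ slopePen Q (rowNorms G) := by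
        refine Finset.sum_nonneg fun j _ => mul_nonneg ?_ (abs_nonneg _)
        refine chi_quantile_nonneg K _ ?_
        have h1 : ((j : ℕ) : ℝ) + 1 ≤ p := by exact_mod_cast j.isLt
        rw [sub_pos, div_lt_one hpp]
        nlinarith
      have h1 := fip_le (Matrix.of Z) (G * Hᵀ)
      rw [frobSq_mul_right H hH] at h1
      have h2 : √F ≤ √(R Z) := by
        refine Real.sqrt_le_sqrt ?_
        rw [hRZ Z, Set.indicator_of_mem hb, ← hF]
        have h3 : F ≤ F ^ 2 / p ^ 2 + p ^ 2 := by
          have h4 : F = F / p * p := by field_simp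
          have h5 : F ^ 2 / p ^ 2 = (F / p) ^ 2 := by rw [div_pow]
          rw [h5]
          have h6 : 0 ≤ F / p := by positivity
          nlinarith [sq_nonneg (F / p - p)]
        have h7 : 0 ≤ 36 * m * δ ^ 2 + 4 * m * A Z + 2 * d * K * (1 + F ^ 2 / p ^ 2) := by positivity
        linarith
      have h8 := mul_le_mul_of_nonneg_right h2 (Real.sqrt_nonneg (frobSq G))
      linarith
    · obtain ⟨H', hH'T, hH'⟩ := hTn H hH
      have hsplit : fip (Matrix.of Z) (G * Hᵀ) =
          fip (Matrix.of Z * H') G + fip (Matrix.of Z * (H - H')) G := by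
        have e : ∀ (A B : Matrix (Fin p) (Fin K) ℝ), fip A B = fip B A := by
          intro A B; simp [fip, mul_comm]
        have e' : ∀ (A B : Matrix (Fin p) (Fin d) ℝ), fip A B = fip B A := by
          intro A B; simp [fip, mul_comm]
        rw [e' _ (G * Hᵀ), ← fip_mul_right, e G, Matrix.mul_sub]
        simp only [fip, Matrix.sub_apply]
        rw [← Finset.sum_add_distrib]
        refine Finset.sum_congr rfl fun i _ => ?_
        rw [← Finset.sum_add_distrib]
        exact Finset.sum_congr rfl fun i _ => by ring
      have hdelta : frobSq (Matrix.of Z * (H - H')) ≤ d * K * (F / p ^ 2) := by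
        refine (frobSq_mul_le _ _).trans ?_
        have : frobSq (H - H') ≤ d * K * (1 / p) ^ 2 := by
          calc frobSq (H - H') ≤ ∑ i : Fin d, ∑ k : Fin K, (1 / (p:ℝ)) ^ 2 := by
                refine Finset.sum_le_sum fun i _ => Finset.sum_le_sum fun k _ => ?_
                rw [← sq_abs, Matrix.sub_apply]
                exact pow_le_pow_left₀ (abs_nonneg _) (hH' i k) 2
            _ = _ := by simp; ring
        calc F * frobSq (H - H') ≤ F * (d * K * (1 / p) ^ 2) := by gcongr
          _ = _ := by field_simp
      have hdet := det_slope (fun i => √(∑ k, (Matrix.of Z * H') i k ^ 2)) (rowNorms G) Q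
        (fun i => Real.sqrt_nonneg _) (3 * δ + √(A Z)) (by positivity) m ?_ ?_
      · rw [rowNorms_sq_sum] at hdet
        have h1 := fip_le_rows (Matrix.of Z * H') G
        have h2 := fip_le (Matrix.of Z * (H - H')) G
        have h3 : √(frobSq (Matrix.of Z * (H - H'))) ≤ √(d * K * (F / p ^ 2)) := Real.sqrt_le_sqrt hdelta
        have h4 : √m * (3 * δ + √(A Z)) + √(d * K * (F / p ^ 2)) ≤ √(R Z) := by
          refine Real.le_sqrt_of_sq_le ?_
          set x := √m * (3 * δ + √(A Z)) with hx
          set y := √(d * K * (F / p ^ 2)) with hy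
          have hy2 : y ^ 2 = d * K * (F / p ^ 2) := Real.sq_sqrt (by positivity)
          have hx2 : x ^ 2 = m * (3 * δ + √(A Z)) ^ 2 := by
            rw [hx, mul_pow, Real.sq_sqrt (by positivity)]
          have hx3 : (3 * δ + √(A Z)) ^ 2 ≤ 18 * δ ^ 2 + 2 * A Z := by
            have := Real.sq_sqrt hAZ
            nlinarith [sq_nonneg (3 * δ - √(A Z))]
          have hx4 : x ^ 2 ≤ m * (18 * δ ^ 2 + 2 * A Z) := by
            rw [hx2]; gcongr
          have hy4 : y ^ 2 ≤ d * K * (1 + F ^ 2 / p ^ 2) := by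
            rw [hy2]; gcongr
          have hI := hind0 Z
          have hI2 : 0 ≤ (p:ℝ) ^ 2 * Bad.indicator (fun _ => (1:ℝ)) Z := by positivity
          have h5 : (x + y) ^ 2 ≤ 2 * x ^ 2 + 2 * y ^ 2 := by nlinarith [sq_nonneg (x - y)]
          rw [hRZ Z]
          linarith
        have h6 : 0 ≤ √(frobSq G) := Real.sqrt_nonneg _
        have h7 := mul_le_mul_of_nonneg_right h3 h6
        have h8 := mul_le_mul_of_nonneg_right h4 h6
        rw [hsplit]
        linarith
      · intro j hj i
        have h1 := row_orth_le H' (hTo H' hH'T) (Matrix.of Z) i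
        have h2 : √(∑ l, Z i l ^ 2) - (l + δ) ≤ √(A Z) := by
          refine (le_max_left _ 0).trans (Real.le_sqrt_of_sq_le ?_)
          exact Finset.single_le_sum (f := fun i => (max (√(∑ l, Z i l ^ 2) - (l + δ)) 0) ^ 2)
            (fun i _ => sq_nonneg _) (Finset.mem_univ i)
        have h3 := hQ j hj
        simp only [Matrix.of_apply] at h1
        simp only [hQdef]
        linarith
      · intro j hj
        by_contra! hlt
        refine hb ?_
        simp only [Bad, Set.mem_iUnion]
        exact ⟨H', hH'T, j, Finset.mem_filter.2 ⟨Finset.mem_univ _, hj⟩, hlt⟩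

set_option maxHeartbeats 2000000 in
lemma main_p (K d : ℕ) (hK : 1 ≤ K) (q ε : ℝ) (hq0 : 0 < q) (hq1 : q < 1) (hε : 0 < ε) :
    ∀ᶠ p : ℕ in atTop, ∃ R : (Fin p → Fin d → ℝ) → ℝ, (∀ Z, 0 ≤ R Z) ∧ Integrable R (gm p d 1) ∧
      ∫ Z, R Z ∂(gm p d 1) ≤ ε * Real.log p ∧
      ∀ (Z : Fin p → Fin d → ℝ) (H : Matrix (Fin d) (Fin K) ℝ) (G : Matrix (Fin p) (Fin K) ℝ),
        Hᵀ * H = 1 → fip (Matrix.of Z) (G * Hᵀ) ≤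
          slopePen (fun j => chiQuantile K (1 - q * ((j : ℕ) + 1) / (p : ℝ))) (rowNorms G) +
            √(R Z) * √(frobSq G) := by
  obtain ⟨M, hM0, hM⟩ := fourth_moment d
  set r := q * Real.exp (1 - q) with hr
  have hr0 : 0 < r := by positivity
  have hr1 : r < 1 := by
    have h1 : q < Real.exp (q - 1) := by
      have := Real.add_one_lt_exp (x := q - 1) (by linarith)
      linarith
    have h2 : Real.exp (q - 1) * Real.exp (1 - q) = 1 := by rw [← Real.exp_add]; simp
    calc r < Real.exp (q - 1) * Real.exp (1 - q) := by rw [hr]; gcongr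
      _ = 1 := h2
  have hlr : 0 < -Real.log r := by linarith [Real.log_neg hr0 hr1]
  set C : ℝ := (d * K + 3) / (-Real.log r) with hC
  have hC0 : 0 < C := by positivity
  have hCr : C * Real.log r = -(d * K + 3) := by
    rw [hC, div_mul_eq_mul_div, div_eq_iff hlr.ne']; ring
  -- choice of δ
  obtain ⟨δ, hδ0, hδ1, hδ⟩ : ∃ δ : ℝ, 0 < δ ∧ δ ≤ 1 ∧ 36 * C * δ ^ 2 ≤ ε / 2 := by
    refine ⟨min 1 (ε / (72 * C)), by positivity, min_le_left _ _, ?_⟩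
    have h0 : 0 < min 1 (ε / (72 * C)) := by positivity
    have h1 : min 1 (ε / (72 * C)) ^ 2 ≤ ε / (72 * C) := by
      nlinarith [min_le_left 1 (ε / (72 * C)), min_le_right 1 (ε / (72 * C))]
    calc 36 * C * min 1 (ε / (72 * C)) ^ 2 ≤ 36 * C * (ε / (72 * C)) := by gcongr
      _ = ε / 2 := by field_simp; norm_num
  have hlog : Tendsto (fun p : ℕ => Real.log p) atTop atTop :=
    Real.tendsto_log_atTop.comp tendsto_natCast_atTop_atTop
  have hl : Tendsto (fun p : ℕ => √(2 * Real.log p)) atTop atTop :=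
    Real.tendsto_sqrt_atTop.comp (hlog.const_mul_atTop (by norm_num))
  -- the two asymptotic facts
  set c1 : ℝ := 4 * (4 * Real.exp (1 / 2)) * (C + 1) * 2 ^ d with hc1
  have hc1p : 0 < c1 := by positivity
  set c2 : ℝ := δ * (√(2 * Real.pi))⁻¹ * Real.exp (-δ ^ 2 / 2) with hc2
  have hc2p : 0 < c2 := by
    have := Real.pi_pos
    positivity
  have f1 : ∀ᶠ x : ℝ in atTop, c1 * x ^ (d + 2) ≤ Real.exp (δ * x) := by
    have := (isLittleO_pow_exp_pos_mul_atTop (d + 2) hδ0).def (c := c1⁻¹) (by positivity)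
    filter_upwards [this, eventually_ge_atTop 0] with x hx hx0
    rw [Real.norm_of_nonneg (by positivity), Real.norm_of_nonneg (by positivity)] at hx
    calc c1 * x ^ (d + 2) ≤ c1 * (c1⁻¹ * Real.exp (δ * x)) := by gcongr
      _ = _ := by field_simp
  have f2 : ∀ᶠ x : ℝ in atTop, (C + 1) * x ^ 2 < c2 * Real.exp (δ * x) := by
    have := (isLittleO_pow_exp_pos_mul_atTop 2 hδ0).def (c := c2 / (2 * (C + 1))) (by positivity)
    filter_upwards [this, eventually_ge_atTop 0] with x hx hx0
    rw [Real.norm_of_nonneg (by positivity), Real.norm_of_nonneg (by positivity)] at hx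
    have h1 : (C + 1) * x ^ 2 ≤ c2 * Real.exp (δ * x) / 2 := by
      calc (C + 1) * x ^ 2 ≤ (C + 1) * (c2 / (2 * (C + 1)) * Real.exp (δ * x)) := by gcongr
        _ = _ := by field_simp
    have : 0 < c2 * Real.exp (δ * x) := by positivity
    linarith
  set W : ℝ := 36 + 1 + 2 * d * K * (1 + M) + M + 3 ^ (d * K) with hW
  filter_upwards [eventually_gt_atTop 0, hl.eventually f1, hl.eventually f2,
    hl.eventually (eventually_ge_atTop 2), hlog.eventually (eventually_ge_atTop (2 * W / ε))]
    with p hp hf1 hf2 hl2 hlW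
  set l := √(2 * Real.log p) with hldef
  have hpp : (0:ℝ) < p := by exact_mod_cast hp
  have hp1 : (1:ℝ) ≤ p := by exact_mod_cast hp
  have hL0 : 0 ≤ Real.log p := Real.log_nonneg hp1
  have hlsq : l ^ 2 = 2 * Real.log p := Real.sq_sqrt (by positivity)
  have hpexp : Real.exp (Real.log p) = p := Real.exp_log hpp
  set m := ⌈C * Real.log p⌉₊ with hm
  have hm1 : C * Real.log p ≤ m := Nat.le_ceil _
  have hm2 : (m:ℝ) ≤ C * Real.log p + 1 := (Nat.ceil_lt_add_one (by positivity)).le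
  have hm3 : (m:ℝ) ≤ (C + 1) * l ^ 2 := by
    rw [hlsq]
    nlinarith
  have hQ : ∀ j : Fin p, j.val < m → l - 2 * δ ≤ chiQuantile K (1 - q * ((j : ℕ) + 1) / (p : ℝ)) := by
    intro j hj
    by_contra! hlt
    have h1 := chi_quantile_le K (1 - q * ((j : ℕ) + 1) / (p : ℝ)) (by
        have : 0 < q * ((j : ℕ) + 1) / (p : ℝ) := by positivity
        linarith)
    have h2 := chiCDF_mono K hlt.le
    have h3 := chi_tail_lower K hK (l - 2 * δ) δ (by linarith) hδ0
    have h4 : q * ((j : ℕ) + 1) / (p : ℝ) ≤ m / p := by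
      have h5 : ((j:ℕ):ℝ) + 1 ≤ m := by exact_mod_cast hj
      gcongr
      calc q * (((j:ℕ):ℝ) + 1) ≤ 1 * (((j:ℕ):ℝ) + 1) := by gcongr
        _ ≤ m := by linarith
    have h6 : δ * ((√(2 * Real.pi))⁻¹ * Real.exp (-(l - 2 * δ + δ) ^ 2 / 2)) =
        c2 * Real.exp (δ * l) / p := by
      have h7 : -(l - 2 * δ + δ) ^ 2 / 2 = -δ ^ 2 / 2 + δ * l - Real.log p := by
        linear_combination (-1 / 2) * hlsq
      rw [h7, Real.exp_sub, Real.exp_add, hpexp, hc2]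
      ring
    have h8 : c2 * Real.exp (δ * l) / p ≤ m / p := by linarith
    rw [div_le_div_iff_of_pos_right hpp] at h8
    linarith
  obtain ⟨R, hR0, hRi, hRv, hRd⟩ := fixed_p p K d m hp q δ l M hq0 hq1 hδ0 (by linarith)
    (by nlinarith) hr1.le (hM p) hQ
  refine ⟨R, hR0, hRi, hRv.trans ?_, hRd⟩
  have t1 : 36 * m * δ ^ 2 ≤ ε / 2 * Real.log p + 36 := by
    have : 36 * m * δ ^ 2 ≤ 36 * (C * Real.log p + 1) * δ ^ 2 := by gcongr
    have h2 : δ ^ 2 ≤ 1 := by nlinarith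
    have h3 := mul_le_mul_of_nonneg_right hδ hL0
    nlinarith
  have t2 : 4 * m * (p * (4 * Real.exp (1 / 2) * Real.exp (-(l + δ) ^ 2 / 2) * (l + δ) ^ d)) ≤ 1 := by
    have h1 : (p:ℝ) * Real.exp (-(l + δ) ^ 2 / 2) ≤ Real.exp (-(δ * l)) := by
      conv_lhs => rw [← hpexp, ← Real.exp_add]
      refine Real.exp_le_exp.2 ?_
      nlinarith [sq_nonneg δ]
    have h2 : (l + δ) ^ d ≤ (2 * l) ^ d := by
      gcongr
      linarith
    calc 4 * m * (p * (4 * Real.exp (1 / 2) * Real.exp (-(l + δ) ^ 2 / 2) * (l + δ) ^ d))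
        = 4 * (4 * Real.exp (1 / 2)) * m * (p * Real.exp (-(l + δ) ^ 2 / 2)) * (l + δ) ^ d := by ring
      _ ≤ 4 * (4 * Real.exp (1 / 2)) * ((C + 1) * l ^ 2) * Real.exp (-(δ * l)) * (2 * l) ^ d := by gcongr
      _ = (c1 * l ^ (d + 2)) * Real.exp (-(δ * l)) := by rw [hc1, mul_pow]; ring
      _ ≤ Real.exp (δ * l) * Real.exp (-(δ * l)) := by gcongr
      _ = 1 := by rw [← Real.exp_add]; simp
  have t3 : (p:ℝ) ^ 2 * ((2 * p + 1) ^ (d * K) * p * r ^ m) ≤ 3 ^ (d * K) := by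
    have h1 : r ^ m ≤ ((p:ℝ) ^ (d * K + 3))⁻¹ := by
      have e1 : r ^ m = Real.exp (m * Real.log r) := by
        rw [Real.exp_nat_mul, Real.exp_log hr0]
      have e2 : ((p:ℝ) ^ (d * K + 3))⁻¹ = Real.exp (-((d * K + 3 : ℕ) * Real.log p)) := by
        rw [Real.exp_neg, Real.exp_nat_mul, hpexp]
      rw [e1, e2]
      refine Real.exp_le_exp.2 ?_
      push_cast
      have : (m:ℝ) * Real.log r ≤ C * Real.log p * Real.log r :=
        mul_le_mul_of_nonpos_right hm1 (by linarith)
      calc _ ≤ _ := this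
        _ = C * Real.log r * Real.log p := by ring
        _ = _ := by rw [hCr]; ring
    have h2 : (2 * (p:ℝ) + 1) ^ (d * K) ≤ (3 * p) ^ (d * K) := by
      gcongr
      linarith
    calc (p:ℝ) ^ 2 * ((2 * p + 1) ^ (d * K) * p * r ^ m)
        ≤ (p:ℝ) ^ 2 * ((3 * p) ^ (d * K) * p * ((p:ℝ) ^ (d * K + 3))⁻¹) := by gcongr
      _ = 3 ^ (d * K) * ((p:ℝ) ^ (d * K + 3) * ((p:ℝ) ^ (d * K + 3))⁻¹) := by rw [mul_pow]; ring
      _ = 3 ^ (d * K) := by rw [mul_inv_cancel₀ (by positivity), mul_one]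
  have t4 : W ≤ ε / 2 * Real.log p := by
    rw [div_le_iff₀ hε] at hlW
    linarith
  rw [hW] at t4
  linarith

lemma sparse_sum {p : ℕ} (P : Fin p → Prop) (a : Fin p → ℝ) (s : ℕ) (c : ℝ) (hc : 0 ≤ c)
    (h1 : ∀ j, P j → a j ≤ c) (h2 : ∀ j, ¬ P j → a j ≤ 0) (hs : {j | P j}.ncard ≤ s) :
    ∑ j, a j ≤ s * c := by
  classical
  have h3 : ∀ j ∈ (Finset.univ : Finset (Fin p)), a j ≤ if P j then c else 0 := by
    intro j _
    split_ifs with h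
    · exact h1 j h
    · exact h2 j h
  refine (Finset.sum_le_sum h3).trans ?_
  rw [← Finset.sum_filter, Finset.sum_const, nsmul_eq_mul]
  gcongr
  rw [Set.ncard_eq_toFinset_card'] at hs
  refine le_trans (le_of_eq ?_) hs
  congr 1
  ext j
  simp

lemma frob_sparse {p K d s : ℕ} (αbar : ℝ) (G : Matrix (Fin p) (Fin K) ℝ)
    (H : Matrix (Fin d) (Fin K) ℝ)
    (hs : {j : Fin p | G j ≠ 0}.ncard ≤ s) (hα : ∀ j, rowNorms (G * Hᵀ) j ≤ αbar) :
    frobSq (G * Hᵀ) ≤ s * αbar ^ 2 := by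
  rw [← rowNorms_sq_sum]
  refine sparse_sum (fun j => G j ≠ 0) _ s _ (sq_nonneg _) (fun j _ => ?_) (fun j hj => ?_) hs
  · exact pow_le_pow_left₀ (Real.sqrt_nonneg _) (hα j) 2
  · have h' : ∀ k, G j k = 0 := fun k => congrFun (not_not.1 hj) k
    simp [rowNorms, Matrix.mul_apply, h']

lemma frobSq_sub {m n : ℕ} (A B : Matrix (Fin m) (Fin n) ℝ) :
    frobSq (A - B) = frobSq A - 2 * fip A B + frobSq B := by
  simp only [frobSq, fip, Matrix.sub_apply, Finset.mul_sum, ← Finset.sum_sub_distrib,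
    ← Finset.sum_add_distrib]
  refine Finset.sum_congr rfl fun i _ => Finset.sum_congr rfl fun j _ => by ring

lemma fip_comm {m n : ℕ} (A B : Matrix (Fin m) (Fin n) ℝ) : fip A B = fip B A := by
  simp [fip, mul_comm]

lemma fip_add {m n : ℕ} (A B C : Matrix (Fin m) (Fin n) ℝ) :
    fip (A + B) C = fip A C + fip B C := by
  simp only [fip, Matrix.add_apply, add_mul, Finset.sum_add_distrib]

lemma slopePen_smul {p : ℕ} (a : ℝ) (lam x : Fin p → ℝ) :
    slopePen (fun j => a * lam j) x = a * slopePen lam x := by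
  simp only [slopePen, Finset.mul_sum, mul_assoc]

/-- deterministic bound on the loss -/
lemma det_loss {n p K d s : ℕ} (σ αbar RZ : ℝ) (hσ : 0 < σ) (hR : 0 ≤ RZ)
    (X : Matrix (Fin n) (Fin p) ℝ) (hX : Xᵀ * X = 1) (Q : Fin p → ℝ)
    (Gs : Matrix (Fin p) (Fin K) ℝ) (Hs : Matrix (Fin d) (Fin K) ℝ)
    (hs : {j : Fin p | Gs j ≠ 0}.ncard ≤ s) (hα : ∀ j, rowNorms (Gs * Hsᵀ) j ≤ αbar)
    (E : Matrix (Fin n) (Fin d) ℝ)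
    (G : Matrix (Fin p) (Fin K) ℝ) (H : Matrix (Fin d) (Fin K) ℝ) (hH : Hᵀ * H = 1)
    (hopt : (1 / 2) * frobSq (X * Gs * Hsᵀ + E - X * G * Hᵀ) +
        slopePen (fun j => σ * Q j) (rowNorms G) ≤
      (1 / 2) * frobSq (X * Gs * Hsᵀ + E - X * (0 : Matrix (Fin p) (Fin K) ℝ) * Hᵀ) +
        slopePen (fun j => σ * Q j) (rowNorms (0 : Matrix (Fin p) (Fin K) ℝ)))
    (hZ : fip (Xᵀ * E) (G * Hᵀ) ≤ σ * (slopePen Q (rowNorms G) + √RZ * √(frobSq G))) :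
    ∑ j, (rowNorms (G * Hᵀ) j - rowNorms (Gs * Hsᵀ) j) ^ 2 ≤
      18 * (s * αbar ^ 2) + 16 * σ ^ 2 * RZ := by
  have hb := frob_sparse αbar Gs Hs hs hα
  have h0 : slopePen (fun j => σ * Q j) (rowNorms (0 : Matrix (Fin p) (Fin K) ℝ)) = 0 := by
    simp [slopePen, rowNorms]
  rw [h0, slopePen_smul, frobSq_sub, Matrix.mul_zero, Matrix.zero_mul, sub_zero,
    Matrix.mul_assoc X G, frobSq_mul_left X hX, frobSq_mul_right H hH, fip_add, Matrix.mul_assoc X Gs,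
    fip_comm E, ← fip_mul_left X (Gs * Hsᵀ), ← fip_mul_left X (G * Hᵀ) E, fip_comm _ (Xᵀ * E),
    ← Matrix.mul_assoc Xᵀ X, hX, Matrix.one_mul] at hopt
  have hcs := fip_le (Gs * Hsᵀ) (G * Hᵀ)
  rw [frobSq_mul_right H hH] at hcs
  set g := √(frobSq G) with hg
  set b := √(frobSq (Gs * Hsᵀ)) with hbdef
  have hg0 : 0 ≤ g := Real.sqrt_nonneg _
  have hb0 : 0 ≤ b := Real.sqrt_nonneg _
  have hg2 : g ^ 2 = frobSq G := Real.sq_sqrt (frobSq_nonneg _)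
  have hb2 : b ^ 2 = frobSq (Gs * Hsᵀ) := Real.sq_sqrt (frobSq_nonneg _)
  have hr2 : (√RZ) ^ 2 = RZ := Real.sq_sqrt hR
  have hr0 : 0 ≤ √RZ := Real.sqrt_nonneg _
  have hmain : g ^ 2 ≤ 2 * (b + σ * √RZ) * g := by
    rw [hg2]
    linarith
  have hu : 0 ≤ b + σ * √RZ := by positivity
  have hg3 : g ≤ 2 * (b + σ * √RZ) := by
    by_contra! hlt
    nlinarith
  have hg4 : g ^ 2 ≤ 8 * b ^ 2 + 8 * (σ ^ 2 * RZ) := by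
    have h1 : g ^ 2 ≤ (2 * (b + σ * √RZ)) ^ 2 := pow_le_pow_left₀ hg0 hg3 2
    have h2 : (σ * √RZ) ^ 2 = σ ^ 2 * RZ := by rw [mul_pow, hr2]
    nlinarith [sq_nonneg (b - σ * √RZ)]
  have hsum : ∑ j, (rowNorms (G * Hᵀ) j - rowNorms (Gs * Hsᵀ) j) ^ 2 ≤
      2 * frobSq (G * Hᵀ) + 2 * frobSq (Gs * Hsᵀ) := by
    rw [← rowNorms_sq_sum, ← rowNorms_sq_sum, Finset.mul_sum, Finset.mul_sum, ← Finset.sum_add_distrib]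
    refine Finset.sum_le_sum fun j _ => ?_
    nlinarith [sq_nonneg (rowNorms (G * Hᵀ) j + rowNorms (Gs * Hsᵀ) j)]
  rw [frobSq_mul_right H hH, ← hg2, ← hb2] at hsum
  rw [← hb2] at hb
  linarith

/-- Theorem 2 (asymptotic risk upper bound): for the TgSLOPE estimator under orthogonal
designs, with `p_t → ∞` and `s_t/p_t → 0`, the worst-case risk
`sup E‖[[B̂]] − [[B*]]‖²` over `s_t`-row-sparse, `ᾱ`-row-bounded truths satisfies
`limsup_t sup E‖[[B̂]] − [[B*]]‖² / (2σ² s_t log(p_t/s_t)) ≤ 1`. -/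
theorem tgslope_asymptotic_minimax_upper {Ω : Type*} [MeasurableSpace Ω] (μ : Measure Ω)
    [IsProbabilityMeasure μ]
    (σ q αbar : ℝ) (hσ : 0 < σ) (hq0 : 0 < q) (hq1 : q < 1) (hαbar : 0 < αbar)
    (K d : ℕ) (hK : 1 ≤ K) (hKd : K ≤ d)
    (p s n : ℕ → ℕ) (hppos : ∀ t, 0 < p t) (hspos : ∀ t, 0 < s t)
    (hpn : ∀ t, p t ≤ n t)
    (hpTop : Tendsto (fun t => (p t : ℝ)) atTop atTop)
    (hsp : Tendsto (fun t => (s t : ℝ) / (p t : ℝ)) atTop (nhds 0))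
    (X : ∀ t, Matrix (Fin (n t)) (Fin (p t)) ℝ) (hX : ∀ t, (X t)ᵀ * X t = 1)
    (lam : ∀ t, Fin (p t) → ℝ)
    (hlam : ∀ t (j : Fin (p t)),
      lam t j = σ * chiQuantile K (1 - q * ((j : ℕ) + 1) / (p t : ℝ)))
    (E : ∀ t, Ω → Fin (n t) → Fin d → ℝ) (hEmeas : ∀ t, Measurable (E t))
    (hE : ∀ t, Measure.map (E t) μ =
      Measure.pi fun _ : Fin (n t) => Measure.pi fun _ : Fin d =>
        gaussianReal 0 (σ ^ 2).toNNReal)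
    (Ghat : ∀ t, (Fin (n t) → Fin d → ℝ) → Matrix (Fin (p t)) (Fin K) ℝ)
    (Hhat : ∀ t, (Fin (n t) → Fin d → ℝ) → Matrix (Fin d) (Fin K) ℝ)
    (hGmeas : ∀ t i k, Measurable fun Y : Fin (n t) → Fin d → ℝ => Ghat t Y i k)
    (hHmeas : ∀ t i k, Measurable fun Y : Fin (n t) → Fin d → ℝ => Hhat t Y i k)
    (hopt : ∀ t (Y : Fin (n t) → Fin d → ℝ),
      (Hhat t Y)ᵀ * Hhat t Y = 1 ∧
        ∀ (G : Matrix (Fin (p t)) (Fin K) ℝ) (H : Matrix (Fin d) (Fin K) ℝ),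
          Hᵀ * H = 1 →
            (1 / 2) * frobSq (Matrix.of Y - X t * Ghat t Y * (Hhat t Y)ᵀ) +
                slopePen (lam t) (rowNorms (Ghat t Y)) ≤
              (1 / 2) * frobSq (Matrix.of Y - X t * G * Hᵀ) +
                slopePen (lam t) (rowNorms G))
    (S : ℕ → ℝ)
    (hS : ∀ t, S t = sSup {r : ℝ |
      ∃ (Gstar : Matrix (Fin (p t)) (Fin K) ℝ) (Hstar : Matrix (Fin d) (Fin K) ℝ),
        Hstarᵀ * Hstar = 1 ∧
        {j : Fin (p t) | Gstar j ≠ 0}.ncard ≤ s t ∧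
        (∀ j, rowNorms (Gstar * Hstarᵀ) j ≤ αbar) ∧
        r = ∫ ω, (∑ j,
          (rowNorms (Ghat t (fun i l => (X t * Gstar * Hstarᵀ + Matrix.of (E t ω)) i l) *
              (Hhat t (fun i l => (X t * Gstar * Hstarᵀ + Matrix.of (E t ω)) i l))ᵀ) j -
            rowNorms (Gstar * Hstarᵀ) j) ^ 2) ∂μ}) :
    limsup (fun t => S t / (2 * σ ^ 2 * (s t : ℝ) * Real.log ((p t : ℝ) / (s t : ℝ))))
      atTop ≤ 1 := by
  have hpN : Tendsto p atTop atTop := tendsto_natCast_atTop_iff.1 hpTop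
  have hmain := hpN.eventually (main_p K d hK q (1 / 16) hq0 hq1 (by norm_num))
  have hratio : Tendsto (fun t => Real.log ((p t : ℝ) / (s t : ℝ))) atTop atTop := by
    refine Real.tendsto_log_atTop.comp ?_
    have h1 : Tendsto (fun t => (s t : ℝ) / (p t : ℝ)) atTop (nhdsWithin 0 (Set.Ioi 0)) := by
      refine tendsto_nhdsWithin_iff.2 ⟨hsp, Eventually.of_forall fun t => ?_⟩
      have h2 : (0:ℝ) < s t := by exact_mod_cast hspos t
      have h3 : (0:ℝ) < p t := by exact_mod_cast hppos t
      exact div_pos h2 h3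
    have h4 := h1.inv_tendsto_nhdsGT_zero
    refine h4.congr fun t => ?_
    simp
  have hS0 : ∀ t, 0 ≤ S t := by
    intro t
    rw [hS]
    refine Real.sSup_nonneg ?_
    rintro r ⟨Gs, Hs, -, -, -, rfl⟩
    exact integral_nonneg fun ω => Finset.sum_nonneg fun j _ => sq_nonneg _
  refine limsup_le_of_le ?_ ?_
  · refine IsBoundedUnder.isCoboundedUnder_le ⟨0, ?_⟩
    rw [eventually_map]
    filter_upwards [hratio.eventually (eventually_ge_atTop 0)] with t ht
    have := hS0 t
    show 0 ≤ _
    positivity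
  filter_upwards [hmain, hratio.eventually (eventually_ge_atTop 1),
    hratio.eventually (eventually_ge_atTop (18 * αbar ^ 2 / σ ^ 2))] with t hR hl1 hl2
  obtain ⟨R, hR0, hRi, hRv, hRd⟩ := hR
  have hs1 : (1:ℝ) ≤ s t := by exact_mod_cast hspos t
  have hp1 : (1:ℝ) ≤ p t := by exact_mod_cast hppos t
  set L := Real.log ((p t : ℝ) / (s t : ℝ)) with hL
  have hden : 0 < 2 * σ ^ 2 * (s t : ℝ) * L := by positivity
  rw [div_le_one hden, hS]
  refine Real.sSup_le ?_ hden.le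
  rintro r ⟨Gs, Hs, hHs, hsparse, hα, rfl⟩
  set Zf : Ω → Fin (p t) → Fin d → ℝ := fun ω i l => σ⁻¹ * ((X t)ᵀ * Matrix.of (E t ω)) i l with hZf
  have hg : Measurable fun e : Fin (n t) → Fin d → ℝ => fun (i : Fin (p t)) (l : Fin d) =>
      σ⁻¹ * ((X t)ᵀ * Matrix.of e) i l := by
    refine measurable_pi_lambda _ fun i => measurable_pi_lambda _ fun k => ?_
    simp only [Matrix.mul_apply, Matrix.of_apply]
    fun_prop
  have hZm : Measurable Zf := hg.comp (hEmeas t)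
  have hZlaw : Measure.map Zf μ = gm (p t) d 1 := by
    have h1 := gm_law (n t) d (p t) d (σ ^ 2).toNNReal 1 σ⁻¹ (by
      rw [Real.coe_toNNReal _ (sq_nonneg σ)]; simp; field_simp) (X t) (hX t) 1 (by simp)
    simp only [Matrix.mul_one] at h1
    rw [← h1, gm, ← hE t, Measure.map_map hg (hEmeas t)]
    rfl
  have hRZi : Integrable (fun ω => R (Zf ω)) μ := by
    have : Integrable R (Measure.map Zf μ) := by rw [hZlaw]; exact hRi
    exact this.comp_measurable hZm
  have hRZv : ∫ ω, R (Zf ω) ∂μ ≤ 1 / 16 * Real.log (p t) := by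
    have h1 := integral_map (μ := μ) (φ := Zf) hZm.aemeasurable (f := R)
      (by rw [hZlaw]; exact hRi.aestronglyMeasurable)
    rw [← h1, hZlaw]
    exact hRv
  have hdom := integral_mono_of_nonneg (μ := μ)
    (f := fun ω => (∑ j,
          (rowNorms (Ghat t (fun i l => (X t * Gs * Hsᵀ + Matrix.of (E t ω)) i l) *
              (Hhat t (fun i l => (X t * Gs * Hsᵀ + Matrix.of (E t ω)) i l))ᵀ) j -
            rowNorms (Gs * Hsᵀ) j) ^ 2))
    (g := fun ω => 18 * (s t * αbar ^ 2) + 16 * σ ^ 2 * R (Zf ω))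
    (ae_of_all _ fun ω => Finset.sum_nonneg fun j _ => sq_nonneg _)
    ((integrable_const _).add (hRZi.const_mul _))
    (ae_of_all _ fun ω => ?_)
  · refine hdom.trans ?_
    rw [integral_add (integrable_const _) (hRZi.const_mul _)]
    have e : ∫ ω, 16 * σ ^ 2 * R (Zf ω) ∂μ = 16 * σ ^ 2 * ∫ ω, R (Zf ω) ∂μ :=
      integral_const_mul _ _
    rw [e]
    simp only [integral_const, probReal_univ, one_smul]
    have h1 : 18 * αbar ^ 2 ≤ L * σ ^ 2 := by
      rwa [div_le_iff₀ (by positivity)] at hl2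
    have h2 : Real.log (p t) ≤ s t * L := by
      have h3 : Real.log (p t) = L + Real.log (s t) := by
        rw [hL, Real.log_div (by positivity) (by positivity)]; ring
      have h4 := Real.log_le_sub_one_of_pos (show (0:ℝ) < s t by linarith)
      rw [h3]
      nlinarith
    have h5 : 18 * (s t * αbar ^ 2) ≤ s t * (L * σ ^ 2) := by nlinarith
    have h6 : 16 * σ ^ 2 * ∫ ω, R (Zf ω) ∂μ ≤ 16 * σ ^ 2 * (1 / 16 * (s t * L)) := by
      gcongr
      linarith
    linarith
  · set Y : Fin (n t) → Fin d → ℝ := fun i l => (X t * Gs * Hsᵀ + Matrix.of (E t ω)) i l with hY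
    have hYe : Matrix.of Y = X t * Gs * Hsᵀ + Matrix.of (E t ω) := rfl
    obtain ⟨hH, hmin⟩ := hopt t Y
    have hlam' : lam t = fun j : Fin (p t) => σ * chiQuantile K (1 - q * ((j : ℕ) + 1) / (p t : ℝ)) :=
      funext fun j => hlam t j
    have ho := hmin 0 (Hhat t Y) hH
    rw [hYe, hlam'] at ho
    refine det_loss σ αbar (R (Zf ω)) hσ (hR0 _) (X t) (hX t)
      (fun j : Fin (p t) => chiQuantile K (1 - q * ((j : ℕ) + 1) / (p t : ℝ))) Gs Hs hsparse hα
      (Matrix.of (E t ω)) (Ghat t Y) (Hhat t Y) hH ho ?_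
    have h1 := hRd (Zf ω) (Hhat t Y) (Ghat t Y) hH
    have h2 : fip ((X t)ᵀ * Matrix.of (E t ω)) (Ghat t Y * (Hhat t Y)ᵀ) =
        σ * fip (Matrix.of (Zf ω)) (Ghat t Y * (Hhat t Y)ᵀ) := by
      simp only [fip, Finset.mul_sum, hZf, Matrix.of_apply]
      refine Finset.sum_congr rfl fun i _ => Finset.sum_congr rfl fun l _ => ?_
      field_simp
    rw [h2]
    exact mul_le_mul_of_nonneg_left h1 hσ.le
end
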